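/- arXiv:2201.12974 — 4 statements merged into one kernel-verified Lean document; each statement's English description precedes it below -/
import Mathlib

section
/- For α ≥ 1, the set {x ∈ Λ : liminf_{n→∞} (log a_n(x))/(log n) ≤ α} has Hausdorff dimension at most (α-1)/(2α). -/
open Filter MeasureTheory Set

/-- The Gauss map. -/
noncomputable def gaussMap (x : ℝ) : ℝ := Int.fract x⁻¹

/-- The `n`-th partial quotient (for `n ≥ 1`) of the continued fraction expansion of `x`. -/
noncomputable def cfA (n : ℕ) (x : ℝ) : ℕ := ⌊(gaussMap^[n - 1] x)⁻¹⌋₊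

/-- The set `Λ` of points of `(0,1)` whose partial quotients are non-decreasing. -/
noncomputable def Lam : Set ℝ :=
  {x | x ∈ Set.Ioo (0:ℝ) 1 ∧ ∀ n : ℕ, 1 ≤ n → cfA n x ≤ cfA (n + 1) x}

/-- Inverse branches of the Gauss map. -/
noncomputable def phi (K : ℕ) (u : ℝ) : ℝ := 1 / ((K : ℝ) + u)

lemma cfA_one_pos {x : ℝ} (hx : x ∈ Set.Ioo (0:ℝ) 1) : 1 ≤ cfA 1 x := by
  simp only [cfA, Nat.sub_self, Function.iterate_zero, id]
  apply Nat.le_floor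
  have := (one_lt_inv₀ hx.1).2 hx.2
  push_cast; exact this.le

lemma cfA_gauss (x : ℝ) {n : ℕ} (hn : 1 ≤ n) : cfA n (gaussMap x) = cfA (n + 1) x := by
  obtain ⟨m, rfl⟩ : ∃ m, n = m + 1 := ⟨n - 1, by omega⟩
  simp [cfA]

lemma gauss_mem {x : ℝ} (hx : x ∈ Lam) : gaussMap x ∈ Lam := by
  refine ⟨⟨?_, Int.fract_lt_one _⟩, fun n hn => ?_⟩
  · rcases (Int.fract_nonneg x⁻¹).lt_or_eq with h | h
    · exact h
    · exfalso
      have h1 := cfA_one_pos hx.1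
      have h2 : cfA 1 x ≤ cfA 2 x := hx.2 1 le_rfl
      have h3 : cfA 2 x = 0 := by
        have : gaussMap x = 0 := h.symm
        simp [cfA, this]
      omega
  · rw [cfA_gauss x hn, cfA_gauss x (by omega)]
    exact hx.2 _ (by omega)

lemma gauss_iter_mem {x : ℝ} (hx : x ∈ Lam) (j : ℕ) : gaussMap^[j] x ∈ Lam := by
  induction j with
  | zero => exact hx
  | succ j ih => rw [Function.iterate_succ_apply']; exact gauss_mem ih

lemma cfA_iter (x : ℝ) {n : ℕ} (hn : 1 ≤ n) (j : ℕ) :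
    cfA n (gaussMap^[j] x) = cfA (n + j) x := by
  induction j generalizing n with
  | zero => rfl
  | succ j ih =>
    rw [Function.iterate_succ_apply', cfA_gauss _ hn, ih (by omega)]
    congr 1; omega

lemma eq_phi {x : ℝ} (hx : x ∈ Lam) : x = phi (cfA 1 x) (gaussMap x) := by
  have h0 : 0 < x⁻¹ := inv_pos.2 hx.1.1
  have : ((cfA 1 x : ℕ) : ℝ) + gaussMap x = x⁻¹ := by
    simp only [cfA, Nat.sub_self, Function.iterate_zero, id, gaussMap]
    rw [natCast_floor_eq_intCast_floor h0.le]
    exact Int.floor_add_fract _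
  rw [phi, this]; simp

lemma cfA_mono {x : ℝ} (hx : x ∈ Lam) {m n : ℕ} (hm : 1 ≤ m) (hmn : m ≤ n) :
    cfA m x ≤ cfA n x := by
  induction n, hmn using Nat.le_induction with
  | base => exact le_rfl
  | succ n h ih => exact ih.trans (hx.2 n (by omega))

lemma phi_dist {K : ℕ} (hK : 1 ≤ K) {c u v : ℝ} (hc : 0 ≤ c) (hu : c ≤ u) (hv : c ≤ v) :
    |phi K u - phi K v| ≤ 1 / ((K : ℝ) + c) ^ 2 * |u - v| := by
  have hK' : (1 : ℝ) ≤ K := by exact_mod_cast hK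
  have : phi K u - phi K v = (v - u) * (1 / ((K + u) * (K + v))) := by
    unfold phi
    have : (K : ℝ) + u ≠ 0 := by linarith
    have : (K : ℝ) + v ≠ 0 := by linarith
    field_simp; ring
  rw [this, abs_mul, abs_sub_comm v u, mul_comm]
  gcongr
  rw [abs_of_nonneg (by apply one_div_nonneg.2; apply mul_nonneg <;> linarith), sq]
  have : (0:ℝ) ≤ K + u := by linarith
  gcongr

lemma phi_lip {K : ℕ} (hK : 1 ≤ K) :
    LipschitzOnWith (((K : NNReal) ^ 2)⁻¹) (phi K) (Set.Ioo 0 1) := by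
  apply LipschitzOnWith.of_dist_le_mul
  intro u hu v hv
  have := phi_dist hK le_rfl hu.1.le hv.1.le
  simpa [Real.dist_eq] using this

/-- points with all digits equal -/
def constSet (c : ℕ) : Set ℝ := {x | x ∈ Lam ∧ ∀ n, 1 ≤ n → cfA n x = c}

lemma constSet_sub (c : ℕ) : (constSet c).Subsingleton := by
  have key : ∀ n : ℕ, ∀ x ∈ constSet c, ∀ y ∈ constSet c, |x - y| ≤ (1 / (1 + 1 / ((c:ℝ) + 1)) ^ 2) ^ n := by
    intro n
    induction n with
    | zero =>
      intro x hx y hy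
      have := hx.1.1; have := hy.1.1
      simp only [mem_Ioo] at *
      rw [pow_zero, abs_le]; constructor <;> linarith
    | succ n ih =>
      have hG : ∀ x ∈ constSet c, gaussMap x ∈ constSet c := fun x hx =>
        ⟨gauss_mem hx.1, fun n hn => by rw [cfA_gauss x hn]; exact hx.2 _ (by omega)⟩
      have hl : ∀ x ∈ constSet c, 1 / ((c:ℝ) + 1) ≤ x := by
        intro x hx
        have h1 := eq_phi hx.1
        rw [hx.2 1 le_rfl, phi] at h1
        have h2 := (gauss_mem hx.1).1
        rw [h1]
        have : (0:ℝ) ≤ c := by positivity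
        exact one_div_le_one_div_of_le (by linarith [h2.1]) (by linarith [h2.2])
      intro x hx y hy
      have hc : 1 ≤ c := by rw [← hx.2 1 le_rfl]; exact cfA_one_pos hx.1.1
      have h1 := eq_phi hx.1
      have h2 := eq_phi hy.1
      rw [hx.2 1 le_rfl] at h1
      rw [hy.2 1 le_rfl] at h2
      have := phi_dist hc (c := 1 / ((c:ℝ) + 1)) (by positivity) (hl _ (hG x hx)) (hl _ (hG y hy))
      rw [← h1, ← h2] at this
      refine this.trans ?_
      rw [pow_succ' _ n]
      have hc' : (1:ℝ) ≤ c := by exact_mod_cast hc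
      refine mul_le_mul ?_ (ih _ (hG x hx) _ (hG y hy)) (abs_nonneg _) (by positivity)
      apply one_div_le_one_div_of_le (by positivity)
      gcongr
  intro x hx y hy
  have hlt : 1 / (1 + 1 / ((c:ℝ) + 1)) ^ 2 < 1 := by
    rw [div_lt_one (by positivity)]
    apply one_lt_pow₀ _ (by norm_num)
    have : 0 < 1 / ((c:ℝ) + 1) := by positivity
    linarith
  have h0 : |x - y| ≤ 0 := ge_of_tendsto' (tendsto_pow_atTop_nhds_zero_of_lt_one (by positivity) hlt)
    (fun n => key n x hx y hy)
  exact sub_eq_zero.1 (abs_nonpos_iff.1 h0)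

/-- preimages under iterates of the Gauss map do not raise dimension -/
lemma dimH_preimage (X : Set ℝ) (d : ENNReal) (h : dimH X ≤ d) (j : ℕ) :
    dimH {x | x ∈ Lam ∧ gaussMap^[j] x ∈ X} ≤ d := by
  induction j with
  | zero => exact (dimH_mono (fun x hx => hx.2)).trans h
  | succ j ih =>
    set Y := {x | x ∈ Lam ∧ gaussMap^[j] x ∈ X}
    have : {x | x ∈ Lam ∧ gaussMap^[j + 1] x ∈ X} ⊆ ⋃ a : ℕ, phi (a + 1) '' Y := by
      rintro x ⟨hx, hxX⟩
      have h1 := cfA_one_pos hx.1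
      refine mem_iUnion.2 ⟨cfA 1 x - 1, gaussMap x, ⟨gauss_mem hx, hxX⟩, ?_⟩
      rw [Nat.sub_add_cancel h1]
      exact (eq_phi hx).symm
    refine (dimH_mono this).trans ?_
    rw [dimH_iUnion]
    refine iSup_le fun a => le_trans ?_ ih
    exact ((phi_lip (K := a + 1) (by omega)).mono (fun y hy => hy.1.1)).dimH_image_le

/-- Hausdorff content of exponent `d`. -/
noncomputable def content (d : ℝ) : OuterMeasure ℝ :=
  OuterMeasure.boundedBy (fun s : Set ℝ => Metric.ediam s ^ d)

lemma content_le (d : ℝ) (s : Set ℝ) : content d s ≤ Metric.ediam s ^ d :=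
  OuterMeasure.boundedBy_le s

lemma content_image {d : ℝ} (hd : 0 < d) {K : NNReal} (hK0 : K ≠ 0) {f : ℝ → ℝ} {D S : Set ℝ}
    (hf : LipschitzOnWith K f D) (hS : S ⊆ D) :
    content d (f '' S) ≤ (K : ENNReal) ^ d * content d S := by
  unfold content
  rw [OuterMeasure.boundedBy_apply, OuterMeasure.boundedBy_apply]
  have hK : (K : ENNReal) ^ d ≠ ⊤ := ENNReal.rpow_ne_top_of_nonneg hd.le ENNReal.coe_ne_top
  have hK0' : (K : ENNReal) ^ d ≠ 0 := by
    rw [Ne, ENNReal.rpow_eq_zero_iff]; simp [hK0, hd.le]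
  simp only [ENNReal.mul_iInf_of_ne hK0' hK, ← ENNReal.tsum_mul_left]
  refine le_iInf₂ fun t ht => ?_
  refine (iInf₂_le (fun n => f '' (t n ∩ D)) ?_).trans ?_
  · rintro _ ⟨x, hx, rfl⟩
    obtain ⟨n, hn⟩ := mem_iUnion.1 (ht hx)
    exact mem_iUnion.2 ⟨n, x, ⟨hn, hS hx⟩, rfl⟩
  refine ENNReal.tsum_le_tsum fun n => iSup_le fun hne => ?_
  have hne' : (t n).Nonempty := by
    obtain ⟨_, x, hx, rfl⟩ := hne; exact ⟨x, hx.1⟩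
  simp only [hne', iSup_pos]
  rw [← ENNReal.mul_rpow_of_nonneg _ _ hd.le]
  apply ENNReal.rpow_le_rpow _ hd.le
  apply Metric.ediam_le
  rintro _ ⟨x, hx, rfl⟩ _ ⟨y, hy, rfl⟩
  refine (hf hx.2 hy.2).trans ?_
  gcongr
  exact Metric.edist_le_ediam_of_mem hx.1 hy.1

lemma hausdorff_of_content {d : ℝ} (hd : 0 < d) {S : Set ℝ} (h : content d S = 0) :
    μH[d] S = 0 := by
  rw [Measure.hausdorffMeasure_apply]
  simp only [ENNReal.iSup_eq_zero]
  intro r hr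
  refine le_antisymm (ENNReal.le_of_forall_pos_le_add fun ε hε _ => ?_) (zero_le)
  rw [zero_add]
  have hm : 0 < min (ε : ENNReal) (r ^ d) := by
    refine lt_min (by exact_mod_cast hε) ?_
    exact ENNReal.rpow_pos_of_nonneg hr hd.le
  have h' := h.trans_lt hm
  unfold content at h'
  rw [OuterMeasure.boundedBy_apply] at h'
  simp only [iInf_lt_iff] at h'
  obtain ⟨t, ht, hsum⟩ := h'
  refine (iInf₂_le t ht).trans ((iInf_le _ ?_).trans (hsum.le.trans (min_le_left _ _)))
  intro n
  rcases (t n).eq_empty_or_nonempty with he | hne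
  · simp [he]
  have h1 := (ENNReal.le_tsum n).trans (hsum.le.trans (min_le_right _ _))
  simp only [hne, iSup_pos] at h1
  exact (ENNReal.rpow_le_rpow_iff hd).1 h1

/-- points of `Lam` with first digit at least `K` and `n`-th digit at most `N` -/
def Aset (N n K : ℕ) : Set ℝ := {x | x ∈ Lam ∧ K ≤ cfA 1 x ∧ (1 ≤ n → cfA n x ≤ N)}

lemma exp_ineq {u : ℝ} (h0 : 0 ≤ u) (h1 : u ≤ 1 / 2) (s : ℝ) :
    Real.exp s + u * Real.exp (s + 2 * u) ≤ Real.exp (s + 2 * u) := by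
  rw [Real.exp_add]
  have h2 := Real.add_one_le_exp (2 * u)
  have : 1 ≤ (1 - u) * Real.exp (2 * u) := by nlinarith
  nlinarith [Real.exp_pos s]

lemma Aset_content {d : ℝ} (hd : 0 < d) {M : ℕ} (hM1 : 1 ≤ M) (hM : 4 ≤ (M:ℝ) ^ (2 * d))
    (N n : ℕ) (L K : ℕ) (hK : M ≤ K) (hL : N + 1 ≤ K + L) :
    content d (Aset N n K) ≤ ENNReal.ofReal ((1 / 2) ^ n *
      Real.exp (4 * ∑ k ∈ Finset.Ico K (K + L), (k : ℝ) ^ (-(2 * d)))) := by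
  induction n generalizing L K with
  | zero =>
    refine (content_le _ _).trans ?_
    have h1 : Metric.ediam (Aset N 0 K) ≤ 1 := by
      refine (Metric.ediam_mono (t := Set.Ioo 0 1) (fun x hx => hx.1.1)).trans ?_
      simp [Real.ediam_Ioo]
    have h2 : (1:ℝ) ≤ Real.exp (4 * ∑ k ∈ Finset.Ico K (K + L), (k : ℝ) ^ (-(2 * d))) := by
      apply Real.one_le_exp; positivity
    calc _ ≤ (1:ENNReal) ^ d := ENNReal.rpow_le_rpow h1 hd.le
      _ = ENNReal.ofReal 1 := by simp
      _ ≤ _ := ENNReal.ofReal_le_ofReal (by simpa using h2)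
  | succ n ih =>
    induction L generalizing K with
    | zero =>
      have : Aset N (n + 1) K = ∅ := by
        ext x
        simp only [Aset, mem_ofPred_eq, mem_empty_iff_false, iff_false]
        rintro ⟨hx, h1, h2⟩
        have := cfA_mono hx le_rfl (show 1 ≤ n + 1 by omega)
        have := h2 (by omega)
        omega
      rw [this]; simp
    | succ L ihL =>
      have hsub : Aset N (n + 1) K ⊆ Aset N (n + 1) (K + 1) ∪ phi K '' Aset N n K := by
        rintro x ⟨hx, h1, h2⟩
        rcases h1.lt_or_eq with h | h
        · exact Or.inl ⟨hx, h, h2⟩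
        · refine Or.inr ⟨gaussMap x, ⟨gauss_mem hx, ?_, fun hn => ?_⟩, ?_⟩
          · rw [cfA_gauss x le_rfl]; exact h1.trans (hx.2 1 le_rfl)
          · rw [cfA_gauss x hn]; exact h2 (by omega)
          · rw [h]; exact (eq_phi hx).symm
      have hK1 : 1 ≤ K := hM1.trans hK
      have hKpos : (0:ℝ) < K := by exact_mod_cast hK1
      refine (measure_mono hsub).trans ((measure_union_le _ _).trans ?_)
      have e1 := ihL (K + 1) (by omega) (by omega)
      have e2 := (content_image hd (by positivity) (phi_lip hK1) (S := Aset N n K) (fun x hx => hx.1.1)).trans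
        (mul_le_mul_right (ih (L + 1) K hK (by omega)) _)
      have hw : ((((K : NNReal) ^ 2)⁻¹ : NNReal) : ENNReal) ^ d
          = ENNReal.ofReal ((K:ℝ) ^ (-(2 * d))) := by
        rw [← ENNReal.ofReal_coe_nnreal, ENNReal.ofReal_rpow_of_nonneg (by positivity) hd.le]
        congr 1
        push_cast
        rw [Real.rpow_neg hKpos.le, Real.inv_rpow (by positivity), Real.rpow_mul hKpos.le]
        norm_num
      rw [hw, ← ENNReal.ofReal_mul (by positivity)] at e2
      refine (add_le_add e1 e2).trans ?_
      rw [← ENNReal.ofReal_add (by positivity) (by positivity)]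
      apply ENNReal.ofReal_le_ofReal
      rw [Finset.sum_eq_sum_Ico_succ_bot (show K < K + (L + 1) by omega),
        show K + 1 + L = K + (L + 1) by omega]
      set w := (K:ℝ) ^ (-(2 * d)) with hwdef
      set s := ∑ k ∈ Finset.Ico (K + 1) (K + (L + 1)), (k : ℝ) ^ (-(2 * d))
      have hw0 : 0 ≤ w := by positivity
      have hw1 : w ≤ 1 / 4 := by
        have h4 : 4 ≤ (K:ℝ) ^ (2 * d) := hM.trans
          (Real.rpow_le_rpow (by positivity) (by exact_mod_cast hK) (by positivity))
        rw [hwdef, Real.rpow_neg hKpos.le, ← one_div]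
        exact one_div_le_one_div_of_le (by norm_num) h4
      have := exp_ineq (u := 2 * w) (by linarith) (by linarith) (4 * s)
      rw [show 4 * s + 2 * (2 * w) = 4 * (w + s) by ring] at this
      have hp : (0:ℝ) < (1 / 2) ^ n := by positivity
      rw [pow_succ]
      nlinarith

lemma sum_rpow_le {t : ℝ} (h0 : 0 < t) (h1 : t < 1) (N : ℕ) :
    ∑ k ∈ Finset.Ico 1 (N + 1), (k : ℝ) ^ (-t) ≤ (N : ℝ) ^ (1 - t) / (1 - t) := by
  induction N with
  | zero => simp [Real.zero_rpow (by linarith : 1 - t ≠ 0)]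
  | succ N ih =>
    rw [Finset.sum_Ico_succ_top (by omega)]
    have hp : (0:ℝ) < ((N + 1 : ℕ) : ℝ) := by positivity
    set y : ℝ := ((N + 1 : ℕ) : ℝ) with hy
    have hyN : (N : ℝ) = y * (1 + -(1 / y)) := by
      rw [hy]; push_cast; field_simp; ring
    have hy1 : 1 ≤ y := by rw [hy]; push_cast; linarith [Nat.cast_nonneg (α := ℝ) N]
    have hiy : 1 / y ≤ 1 := by rw [div_le_one hp]; exact hy1
    have hb := rpow_one_add_le_one_add_mul_self (s := -(1 / y)) (by linarith)
      (p := 1 - t) (by linarith) (by linarith)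
    have hN : (N : ℝ) ^ (1 - t) ≤ y ^ (1 - t) - (1 - t) * y ^ (-t) := by
      rw [hyN, Real.mul_rpow hp.le (by linarith)]
      calc _ ≤ y ^ (1 - t) * (1 + (1 - t) * -(1 / y)) := by gcongr
        _ = y ^ (1 - t) - (1 - t) * (y ^ (1 - t) / y) := by ring
        _ = _ := by
          rw [← Real.rpow_sub_one hp.ne']; congr 3; ring
    have h2 : 0 < 1 - t := by linarith
    rw [le_div_iff₀ h2] at ih ⊢
    nlinarith

lemma summable_aux {γ C : ℝ} (hγ : γ < 1) :
    Summable (fun m : ℕ => (1 / 2 : ℝ) ^ m * Real.exp (C * (m : ℝ) ^ γ)) := by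
  have hlo : (fun m : ℕ => C * (m : ℝ) ^ γ) =o[atTop] (fun m : ℕ => (m : ℝ)) := by
    refine Asymptotics.IsLittleO.const_mul_left ?_ C
    have h1 : (fun y : ℝ => y ^ γ) =o[atTop] (fun y : ℝ => y) := by
      refine Asymptotics.isLittleO_of_tendsto' ?_ ?_
      · filter_upwards [eventually_gt_atTop 0] with y hy h; linarith
      · refine (tendsto_rpow_neg_atTop (sub_pos.2 hγ)).congr' ?_
        filter_upwards [eventually_gt_atTop 0] with y hy
        rw [← Real.rpow_sub_one hy.ne']; congr 1; ring
    exact h1.comp_tendsto tendsto_natCast_atTop_atTop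
  have hev := hlo.bound (c := 1 / 4) (by norm_num)
  have hr : (1 / 2 : ℝ) * Real.exp (1 / 4) < 1 := by
    have := Real.exp_one_lt_d9
    have h4 : Real.exp (1 / 4) ^ 4 = Real.exp 1 := by rw [← Real.exp_nat_mul]; norm_num
    by_contra hcon
    push Not at hcon
    have h5 : 2 ≤ Real.exp (1 / 4) := by linarith
    have h6 : (2:ℝ) ^ 4 ≤ Real.exp (1 / 4) ^ 4 := by gcongr
    rw [h4] at h6; linarith
  refine Summable.of_norm_bounded_eventually_nat
    (summable_geometric_of_lt_one (by positivity) hr) ?_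
  filter_upwards [hev] with m hm
  rw [Real.norm_of_nonneg (by positivity), mul_pow, ← Real.exp_nat_mul]
  have := (le_abs_self _).trans hm
  rw [Real.norm_of_nonneg (by positivity)] at this
  refine mul_le_mul_of_nonneg_left (Real.exp_le_exp.2 ?_) (by positivity)
  linarith

/-- the tail set -/
def Xset (M : ℕ) (β : ℝ) (c : ℕ) : Set ℝ :=
  {x | x ∈ Lam ∧ M ≤ cfA 1 x ∧ ∃ᶠ m : ℕ in atTop, (cfA m x : ℝ) ≤ c * (m : ℝ) ^ β}

lemma Xset_content {d : ℝ} (hd : 0 < d) (hd2 : 2 * d < 1) {M : ℕ} (hM1 : 1 ≤ M)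
    (hM : 4 ≤ (M:ℝ) ^ (2 * d)) {β : ℝ} (hβ : β * (1 - 2 * d) < 1) (c : ℕ) :
    content d (Xset M β c) = 0 := by
  set A : ℕ → Set ℝ := fun m => Aset ⌊(c:ℝ) * (m : ℝ) ^ β⌋₊ m M with hA
  have hsub : Xset M β c ⊆ {x | ∃ᶠ m in atTop, x ∈ A m} := by
    rintro x ⟨hx, h1, h2⟩
    exact h2.mono fun m hm => ⟨hx, h1, fun _ => Nat.le_floor hm⟩
  refine measure_mono_null hsub (measure_setOfPred_frequently_eq_zero
    (p := fun m x => x ∈ A m) ?_)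
  set C : ℝ := 4 * ((c:ℝ) ^ (1 - 2 * d) / (1 - 2 * d))
  refine ne_top_of_le_ne_top
    (summable_aux (γ := β * (1 - 2 * d)) (C := C) hβ).tsum_ofReal_ne_top
    (ENNReal.tsum_le_tsum fun m => ?_)
  set N := ⌊(c:ℝ) * (m : ℝ) ^ β⌋₊ with hN
  refine (Aset_content hd hM1 hM N m (N + 1 - M) M le_rfl (by omega)).trans ?_
  apply ENNReal.ofReal_le_ofReal
  refine mul_le_mul_of_nonneg_left (Real.exp_le_exp.2 ?_) (by positivity)
  have h1 : ∑ k ∈ Finset.Ico M (M + (N + 1 - M)), (k : ℝ) ^ (-(2 * d)) ≤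
      ∑ k ∈ Finset.Ico 1 (N + 1), (k : ℝ) ^ (-(2 * d)) := by
    apply Finset.sum_le_sum_of_subset_of_nonneg
    · intro k hk
      simp only [Finset.mem_Ico] at *
      omega
    · intros; positivity
  have h2 := sum_rpow_le (t := 2 * d) (by linarith) hd2 N
  have hp : 0 < 1 - 2 * d := by linarith
  have h3 : (N:ℝ) ^ (1 - 2 * d) ≤ (c:ℝ) ^ (1 - 2 * d) * (m:ℝ) ^ (β * (1 - 2 * d)) := by
    rw [Real.rpow_mul (by positivity), ← Real.mul_rpow (by positivity) (by positivity)]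
    exact Real.rpow_le_rpow (by positivity) (Nat.floor_le (by positivity)) hp.le
  have h4 : (N:ℝ) ^ (1 - 2 * d) / (1 - 2 * d) ≤
      (c:ℝ) ^ (1 - 2 * d) * (m:ℝ) ^ (β * (1 - 2 * d)) / (1 - 2 * d) := by gcongr
  calc _ ≤ 4 * ((c:ℝ) ^ (1 - 2 * d) * (m:ℝ) ^ (β * (1 - 2 * d)) / (1 - 2 * d)) := by linarith
    _ = _ := by simp only [C]; ring

lemma freq_shift {x β : ℝ} (hβ : 0 ≤ β) (j : ℕ)
    (h : ∃ᶠ m : ℕ in atTop, (cfA m x : ℝ) ≤ (m : ℝ) ^ β) :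
    ∃ c : ℕ, ∃ᶠ m : ℕ in atTop, (cfA m (gaussMap^[j] x) : ℝ) ≤ c * (m : ℝ) ^ β := by
  obtain ⟨c, hc⟩ := exists_nat_ge (((j:ℝ) + 1) ^ β)
  refine ⟨c, ?_⟩
  rw [frequently_atTop] at h ⊢
  intro a
  obtain ⟨b, hb, hle⟩ := h (a + j + 1)
  refine ⟨b - j, by omega, ?_⟩
  rw [cfA_iter x (by omega), Nat.sub_add_cancel (by omega)]
  refine hle.trans ?_
  have h1 : (b:ℝ) ≤ ((j:ℝ) + 1) * ((b - j : ℕ) : ℝ) := by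
    obtain ⟨e, rfl⟩ : ∃ e, b = e + 1 + j := ⟨b - j - 1, by omega⟩
    rw [Nat.add_sub_cancel]
    push_cast
    nlinarith [Nat.cast_nonneg (α := ℝ) e, Nat.cast_nonneg (α := ℝ) j,
      mul_nonneg (Nat.cast_nonneg (α := ℝ) e) (Nat.cast_nonneg (α := ℝ) j)]
  calc (b:ℝ) ^ β ≤ (((j:ℝ) + 1) * ((b - j : ℕ) : ℝ)) ^ β :=
        Real.rpow_le_rpow (by positivity) h1 hβ
    _ = ((j:ℝ) + 1) ^ β * ((b - j : ℕ) : ℝ) ^ β := Real.mul_rpow (by positivity) (by positivity)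
    _ ≤ _ := by gcongr

lemma exists_constSet {x : ℝ} (hx : x ∈ Lam) {M : ℕ} (h : ∀ n, 1 ≤ n → cfA n x < M) :
    ∃ c j, gaussMap^[j] x ∈ constSet c := by
  have hmono : Monotone (fun n => cfA (n + 1) x) := by
    intro a b hab; exact cfA_mono hx (by omega) (by omega)
  have : ∃ j, ∀ n, j ≤ n → cfA (n + 1) x = cfA (j + 1) x := by
    by_contra hcon
    push Not at hcon
    have key : ∀ k : ℕ, ∃ n, k ≤ cfA (n + 1) x := by
      intro k
      induction k with
      | zero => exact ⟨0, Nat.zero_le _⟩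
      | succ k ih =>
        obtain ⟨n, hn⟩ := ih
        obtain ⟨m, hm, hne⟩ := hcon n
        have := hmono hm
        simp only at this
        exact ⟨m, by omega⟩
    obtain ⟨n, hn⟩ := key M
    have := h (n + 1) (by omega)
    omega
  obtain ⟨j, hj⟩ := this
  refine ⟨cfA (j + 1) x, j, gauss_iter_mem hx j, fun n hn => ?_⟩
  rw [cfA_iter x hn]
  have := hj (n + j - 1) (by omega)
  rwa [show n + j - 1 + 1 = n + j by omega] at this

/-- For `α ≥ 1`, the set of `x ∈ Λ` with `liminf (log aₙ(x))/(log n) ≤ α`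
has Hausdorff dimension at most `(α-1)/(2α)`. -/
theorem dimH_liminf_le_alpha (α : ℝ) (hα : 1 ≤ α) :
    dimH {x | x ∈ Lam ∧
        Filter.liminf (fun n : ℕ => ((Real.log (cfA n x) / Real.log n : ℝ) : EReal)) atTop ≤
          (α : EReal)} ≤
      ENNReal.ofReal ((α - 1) / (2 * α)) := by
  have hα0 : 0 < α := by linarith
  have ha0 : 0 ≤ (α - 1) / (2 * α) := div_nonneg (by linarith) (by linarith)
  have hhalf : ENNReal.ofReal ((α - 1) / (2 * α)) < ENNReal.ofReal (1 / 2) := by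
    rw [ENNReal.ofReal_lt_ofReal_iff (by norm_num), div_lt_div_iff₀ (by linarith) (by norm_num)]
    linarith
  by_contra hcon
  push Not at hcon
  obtain ⟨d', hd1, hd2⟩ := ENNReal.lt_iff_exists_nnreal_btwn.1 (lt_min hcon hhalf)
  have hdS := hd2.trans_le (min_le_left _ _)
  have hdh := hd2.trans_le (min_le_right _ _)
  refine absurd hdS (not_lt.2 ?_)
  set d : ℝ := (d' : ℝ) with hd
  have hd1' : (α - 1) / (2 * α) < d := by
    rw [← ENNReal.ofReal_coe_nnreal] at hd1
    exact (ENNReal.ofReal_lt_ofReal_iff_of_nonneg ha0).1 hd1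
  have hd2' : 2 * d < 1 := by
    rw [← ENNReal.ofReal_coe_nnreal] at hdh
    have := (ENNReal.ofReal_lt_ofReal_iff (by norm_num)).1 hdh
    linarith
  have hd0 : 0 < d := ha0.trans_lt hd1'
  have hαd : α < 1 / (1 - 2 * d) := by
    rw [lt_div_iff₀ (by linarith)]
    rw [div_lt_iff₀ (by linarith)] at hd1'
    linarith
  obtain ⟨β, hβ1, hβ2⟩ := exists_between hαd
  rw [lt_div_iff₀ (by linarith)] at hβ2
  obtain ⟨M, hM, hM1⟩ : ∃ M : ℕ, 4 ≤ (M:ℝ) ^ (2 * d) ∧ 1 ≤ M := by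
    have h1 := (tendsto_rpow_atTop (show 0 < 2 * d by linarith)).comp
      (tendsto_natCast_atTop_atTop (R := ℝ))
    exact ((h1.eventually_ge_atTop 4).and (eventually_ge_atTop 1)).exists
  set X : Set ℝ := (⋃ c, Xset M β c) ∪ ⋃ c, constSet c with hX
  have hXd : dimH X ≤ d' := by
    rw [hX, dimH_union, dimH_iUnion, dimH_iUnion]
    refine max_le (iSup_le fun c => ?_) (iSup_le fun c => ?_)
    · apply dimH_le_of_hausdorffMeasure_ne_top
      rw [hausdorff_of_content hd0 (Xset_content hd0 hd2' hM1 hM hβ2 c)]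
      simp
    · rw [dimH_subsingleton (constSet_sub c)]; exact zero_le
  refine (dimH_mono (t := ⋃ j : ℕ, {x | x ∈ Lam ∧ gaussMap^[j] x ∈ X}) ?_).trans ?_
  · rintro x ⟨hx, hlim⟩
    have hfr : ∃ᶠ m : ℕ in atTop, (cfA m x : ℝ) ≤ (m : ℝ) ^ β := by
      have h1 := frequently_lt_of_liminf_lt (h := hlim.trans_lt (EReal.coe_lt_coe_iff.2 hβ1))
      refine (h1.and_eventually (eventually_ge_atTop 2)).mono ?_
      rintro m ⟨hm, hm2⟩
      have hm2' : (1:ℝ) < m := by exact_mod_cast hm2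
      rw [EReal.coe_lt_coe_iff, div_lt_iff₀ (Real.log_pos hm2')] at hm
      have hpos : 1 ≤ cfA m x := (cfA_one_pos hx.1).trans (cfA_mono hx le_rfl (by omega))
      have hpos' : (0:ℝ) < cfA m x := by exact_mod_cast hpos
      have hmp : (0:ℝ) < m := by linarith
      rw [← Real.log_le_log_iff hpos' (by positivity), Real.log_rpow hmp]
      exact hm.le
    by_cases hb : ∀ n, 1 ≤ n → cfA n x < M
    · obtain ⟨c, j, hcj⟩ := exists_constSet hx hb
      exact mem_iUnion.2 ⟨j, hx, Or.inr (mem_iUnion.2 ⟨c, hcj⟩)⟩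
    · push Not at hb
      obtain ⟨n, hn, hMn⟩ := hb
      obtain ⟨c, hc⟩ := freq_shift (by linarith) (n - 1) hfr
      refine mem_iUnion.2 ⟨n - 1, hx, Or.inl (mem_iUnion.2 ⟨c, gauss_iter_mem hx _, ?_, hc⟩)⟩
      rw [cfA_iter x le_rfl, show 1 + (n - 1) = n by omega]
      exact hMn
  · rw [dimH_iUnion]
    exact iSup_le fun j => dimH_preimage X _ hXd j
end

section
/- The set {x ∈ Λ : liminf_{n→∞} (log a_n(x))/(log n) < 1} has Hausdorff dimension 0. -/
open Filter MeasureTheory Set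

lemma gaussMap_mem (x : ℝ) : 0 ≤ gaussMap x ∧ gaussMap x < 1 :=
  ⟨Int.fract_nonneg _, Int.fract_lt_one _⟩

lemma iter_mem {x : ℝ} (hx : x ∈ Lam) (n : ℕ) :
    0 < gaussMap^[n] x ∧ gaussMap^[n] x < 1 := by
  obtain ⟨⟨h0, h1⟩, hm⟩ := hx
  have hpos : ∀ n, 1 ≤ cfA (n + 1) x := by
    intro n
    induction n with
    | zero =>
      simp only [cfA, Nat.le_floor_iff' one_ne_zero]
      simpa using (one_le_inv₀ h0).2 h1.le
    | succ k ih => exact ih.trans (hm (k + 1) (by omega))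
  have hlt : gaussMap^[n] x < 1 := by
    cases n with
    | zero => simpa using h1
    | succ k => rw [Function.iterate_succ_apply']; exact (gaussMap_mem _).2
  have hge : 0 ≤ gaussMap^[n] x := by
    cases n with
    | zero => simpa using h0.le
    | succ k => rw [Function.iterate_succ_apply']; exact (gaussMap_mem _).1
  refine ⟨lt_of_le_of_ne hge ?_, hlt⟩
  intro h
  have := hpos n
  simp [cfA, ← h] at this

/-- one step -/
lemma step {x y : ℝ} (hx : 0 < x) (hy : 0 < y) (h : ⌊x⁻¹⌋₊ = ⌊y⁻¹⌋₊) :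
    |x - y| = x * y * |gaussMap x - gaussMap y| := by
  have e : ∀ z : ℝ, 0 < z → gaussMap z = z⁻¹ - (⌊z⁻¹⌋₊ : ℝ) := by
    intro z hz
    rw [gaussMap, ← Int.self_sub_floor, natCast_floor_eq_intCast_floor (by positivity)]
  have : x - y = x * y * (gaussMap y - gaussMap x) := by
    rw [e x hx, e y hy, h]; field_simp; ring
  rw [this, abs_mul, abs_of_pos (by positivity), abs_sub_comm]

lemma half {x : ℝ} (hx : 0 < x) (h1 : x < 1) : x * gaussMap x ≤ 1 / 2 := by
  have h := gaussMap_mem x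
  have hi : 1 < x⁻¹ := (one_lt_inv₀ hx).2 h1
  have hf : (1 : ℤ) ≤ ⌊x⁻¹⌋ := Int.le_floor.2 (by exact_mod_cast hi.le)
  have hf' : (1 : ℝ) ≤ (⌊x⁻¹⌋ : ℝ) := by exact_mod_cast hf
  have e : x⁻¹ = ⌊x⁻¹⌋ + gaussMap x := (Int.floor_add_fract _).symm
  have : x * x⁻¹ = 1 := mul_inv_cancel₀ hx.ne'
  rw [e] at this
  nlinarith

lemma contr (n : ℕ) : ∀ x y : ℝ, (∀ i, 0 < gaussMap^[i] x ∧ gaussMap^[i] x < 1) →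
    (∀ i, 0 < gaussMap^[i] y ∧ gaussMap^[i] y < 1) →
    (∀ i < n, cfA (i + 1) x = cfA (i + 1) y) → |x - y| ≤ 2 * (1 / 2) ^ n := by
  induction n using Nat.strong_induction_on with
  | _ n ih =>
    intro x y hx hy h
    have bx := hx 0
    have bY := hy 0
    simp only [Function.iterate_zero, id] at bx bY
    have tr : |x - y| ≤ 1 := by rw [abs_le]; constructor <;> linarith
    match n, ih, h with
    | 0, _, _ => norm_num; linarith
    | 1, _, _ => norm_num; linarith
    | n + 2, ih, h =>
      have cx := hx 1
      have cy := hy 1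
      simp only [Function.iterate_one] at cx cy
      have s1 := step bx.1 bY.1 (by simpa [cfA] using h 0 (by omega))
      have s2 := step cx.1 cy.1 (by simpa [cfA] using h 1 (by omega))
      have := ih n (by omega) (gaussMap (gaussMap x)) (gaussMap (gaussMap y))
        (fun i => by simpa using hx (i + 2)) (fun i => by simpa using hy (i + 2))
        (fun i hi => by simpa [cfA] using h (i + 2) (by omega))
      rw [s1, s2]
      have a := half bx.1 bx.2
      have b := half bY.1 bY.2
      have a0 : 0 < x * gaussMap x := mul_pos bx.1 cx.1
      have b0 : 0 < y * gaussMap y := mul_pos bY.1 cy.1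
      have ab : (x * gaussMap x) * (y * gaussMap y) ≤ 1 / 2 * (1 / 2) := by gcongr
      calc _ = (x * gaussMap x) * (y * gaussMap y) *
            |gaussMap (gaussMap x) - gaussMap (gaussMap y)| := by ring
        _ ≤ (1 / 2 * (1 / 2)) * (2 * (1 / 2) ^ n) := by gcongr
        _ = _ := by ring

lemma mono_cf {x : ℝ} (hx : x ∈ Lam) : Monotone (fun i => cfA (i + 1) x) :=
  monotone_nat_of_le_succ fun n => hx.2 (n + 1) (by omega)

/-- counting function -/
noncomputable def cnt (n j : ℕ) (x : ℝ) : ℕ := ((Finset.range n).filter (fun i => cfA (i + 1) x ≤ j)).card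

lemma cnt_le (n j : ℕ) (x : ℝ) : cnt n j x < n + 1 :=
  Nat.lt_succ_of_le ((Finset.card_filter_le _ _).trans (by simp))

lemma lt_cnt {x : ℝ} (hx : x ∈ Lam) {n j i : ℕ} (hi : i < n) :
    i < cnt n j x ↔ cfA (i + 1) x ≤ j := by
  constructor
  · intro h
    by_contra hc
    have : (Finset.range n).filter (fun i => cfA (i + 1) x ≤ j) ⊆ Finset.range i := by
      intro k hk
      simp only [Finset.mem_filter, Finset.mem_range] at hk ⊢
      by_contra hki
      exact hc ((mono_cf hx (not_lt.1 hki)).trans hk.2)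
    have := Finset.card_le_card this
    simp only [Finset.card_range] at this
    unfold cnt at h
    omega
  · intro h
    have : Finset.range (i + 1) ⊆ (Finset.range n).filter (fun i => cfA (i + 1) x ≤ j) := by
      intro k hk
      simp only [Finset.mem_filter, Finset.mem_range] at hk ⊢
      exact ⟨by omega, (mono_cf hx (show k ≤ i by omega)).trans h⟩
    have := Finset.card_le_card this
    simp only [Finset.card_range] at this
    unfold cnt
    omega

/-- covering sets -/
def cov (n M : ℕ) (t : Fin M → Fin (n + 1)) : Set ℝ :=
  {x | x ∈ Lam ∧ cfA n x ≤ M ∧ ∀ j : Fin M, cnt n j x = t j}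

lemma cov_dist {n M : ℕ} {t : Fin M → Fin (n + 1)} {x y : ℝ} (hx : x ∈ cov n M t)
    (hy : y ∈ cov n M t) : |x - y| ≤ 2 * (1 / 2) ^ n := by
  apply contr n x y (iter_mem hx.1) (iter_mem hy.1)
  have key : ∀ i < n, ∀ j, cfA (i + 1) x ≤ j ↔ cfA (i + 1) y ≤ j := by
    intro i hi j
    by_cases hj : j < M
    · rw [← lt_cnt hx.1 hi, ← lt_cnt hy.1 hi, hx.2.2 ⟨j, hj⟩, hy.2.2 ⟨j, hj⟩]
    · have a : ∀ z ∈ cov n M t, cfA (i + 1) z ≤ j := by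
        intro z hz
        have h1 := mono_cf hz.1 (show i ≤ n - 1 by omega)
        have h2 := hz.2.1
        have e : n - 1 + 1 = n := by omega
        simp only [e] at h1
        omega
      exact ⟨fun _ => a y hy, fun _ => a x hx⟩
  intro i hi
  exact le_antisymm ((key i hi _).2 le_rfl) ((key i hi _).1 le_rfl)

lemma cov_diam {n M : ℕ} (t : Fin M → Fin (n + 1)) :
    Metric.ediam (cov n M t) ≤ ENNReal.ofReal (2 * (1 / 2) ^ n) := by
  apply Metric.ediam_le
  intro x hx y hy
  rw [edist_dist, Real.dist_eq]
  exact ENNReal.ofReal_le_ofReal (cov_dist hx hy)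

lemma summ {α s : ℝ} (h0 : 0 < α) (h1 : α < 1) (hs : 0 < s) :
    Summable (fun n : ℕ => ((n : ℝ) + 1) ^ ⌊(n : ℝ) ^ α⌋₊ * (2 * (1 / 2 : ℝ) ^ n) ^ s) := by
  have hl2 : 0 < Real.log 2 := Real.log_pos (by norm_num)
  set c := s * Real.log 2 / 2 with hc
  have hcp : 0 < c := by positivity
  have hlo := (isLittleO_log_rpow_atTop (show 0 < 1 - α by linarith)).bound hcp
  have ht : Tendsto (fun n : ℕ => (n : ℝ) + 1) atTop atTop :=
    tendsto_atTop_add_const_right _ _ tendsto_natCast_atTop_atTop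
  have hev := ht.eventually hlo
  have hg : Summable (fun n : ℕ => Real.exp (c + s * Real.log 2) * Real.exp (-c) ^ n) :=
    (summable_geometric_of_lt_one (Real.exp_pos _).le (by simpa using hcp)).mul_left _
  refine Summable.of_norm_bounded_eventually_nat hg ?_
  filter_upwards [hev] with n hn
  have hn1 : (0 : ℝ) < n + 1 := by positivity
  have hlog : 0 ≤ Real.log ((n : ℝ) + 1) := Real.log_nonneg (by linarith [n.cast_nonneg (α := ℝ)])
  rw [Real.norm_of_nonneg hlog, Real.norm_of_nonneg (by positivity)] at hn
  rw [Real.norm_of_nonneg (by positivity)]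
  have e1 : ((n : ℝ) + 1) ^ ⌊(n : ℝ) ^ α⌋₊ = Real.exp (⌊(n : ℝ) ^ α⌋₊ * Real.log (n + 1)) := by
    rw [Real.exp_nat_mul, Real.exp_log hn1]
  have e2 : (2 * (1 / 2 : ℝ) ^ n) ^ s = Real.exp ((Real.log 2 - n * Real.log 2) * s) := by
    rw [Real.rpow_def_of_pos (by positivity), Real.log_mul (by norm_num) (by positivity),
      Real.log_pow, one_div, Real.log_inv]
    ring_nf
  rw [e1, e2, ← Real.exp_nat_mul, ← Real.exp_add, ← Real.exp_add, Real.exp_le_exp]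
  have hM : (⌊(n : ℝ) ^ α⌋₊ : ℝ) ≤ ((n : ℝ) + 1) ^ α :=
    (Nat.floor_le (by positivity)).trans
      (Real.rpow_le_rpow (by positivity) (by linarith) h0.le)
  have : (⌊(n : ℝ) ^ α⌋₊ : ℝ) * Real.log (n + 1) ≤ c * (n + 1) :=
    calc _ ≤ ((n : ℝ) + 1) ^ α * (c * ((n : ℝ) + 1) ^ (1 - α)) := by gcongr
      _ = c * (((n : ℝ) + 1) ^ α * ((n : ℝ) + 1) ^ (1 - α)) := by ring
      _ = _ := by rw [← Real.rpow_add hn1]; simp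
  have : s * Real.log 2 = 2 * c := by rw [hc]; ring
  nlinarith

lemma dim_aux {α : ℝ} (h0 : 0 < α) (h1 : α < 1) :
    dimH {x | x ∈ Lam ∧ ∃ᶠ n : ℕ in atTop, (cfA n x : ℝ) ≤ (n : ℝ) ^ α} = 0 := by
  set E := {x | x ∈ Lam ∧ ∃ᶠ n : ℕ in atTop, (cfA n x : ℝ) ≤ (n : ℝ) ^ α} with hE
  have main : ∀ s : NNReal, 0 < s → dimH E ≤ s := by
    intro s hs
    have hs' : (0 : ℝ) < s := hs
    apply dimH_le_of_hausdorffMeasure_ne_top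
    let M : ℕ → ℕ := fun n => ⌊(n : ℝ) ^ α⌋₊
    let f : ℕ → ENNReal := fun n =>
      ENNReal.ofReal (((n : ℝ) + 1) ^ M n * (2 * (1 / 2 : ℝ) ^ n) ^ (s : ℝ))
    have hf : ∑' n, f n ≠ ⊤ := (summ h0 h1 hs').tsum_ofReal_ne_top
    have hlim := ENNReal.tendsto_sum_nat_add f hf
    have hle := Measure.hausdorffMeasure_le_liminf_tsum
      (ι := fun N : ℕ => Σ k : ℕ, (Fin (M (k + N)) → Fin (k + N + 1)))
      (s : ℝ) E (l := atTop) (fun N => ENNReal.ofReal (2 * (1 / 2) ^ N)) (by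
        have : Tendsto (fun N : ℕ => (2 : ℝ) * (1 / 2) ^ N) atTop (nhds 0) := by
          simpa using (tendsto_pow_atTop_nhds_zero_of_lt_one (r := (1 / 2 : ℝ)) (by norm_num)
            (by norm_num)).const_mul 2
        simpa using ENNReal.tendsto_ofReal this)
      (fun N i => cov (i.1 + N) (M (i.1 + N)) i.2)
      (by
        refine Eventually.of_forall fun N i => (cov_diam _).trans (ENNReal.ofReal_le_ofReal ?_)
        have : (1 / 2 : ℝ) ^ (i.1 + N) ≤ (1 / 2) ^ N :=
          pow_le_pow_of_le_one (by norm_num) (by norm_num) (by omega)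
        linarith)
      (by
        refine Eventually.of_forall fun N x hx => ?_
        obtain ⟨n, hn, hxn⟩ := (frequently_atTop.1 hx.2) N
        obtain ⟨k, rfl⟩ : ∃ k, n = k + N := ⟨n - N, by omega⟩
        refine mem_iUnion.2 ⟨⟨k, fun j => ⟨cnt (k + N) j x, cnt_le _ _ _⟩⟩, hx.1, ?_, fun j => rfl⟩
        exact Nat.le_floor hxn)
    have hz : μH[(s : ℝ)] E ≤ 0 := by
      refine hle.trans ?_
      rw [← hlim.liminf_eq]
      refine liminf_le_liminf (Eventually.of_forall fun N => ?_)
      rw [ENNReal.tsum_sigma (fun (k : ℕ) (t : Fin (M (k + N)) → Fin (k + N + 1)) =>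
        Metric.ediam (cov (k + N) (M (k + N)) t) ^ (s : ℝ))]
      refine ENNReal.tsum_le_tsum fun k => ?_
      rw [tsum_fintype]
      calc _ ≤ ∑ _t : (Fin (M (k + N)) → Fin (k + N + 1)),
            ENNReal.ofReal (2 * (1 / 2) ^ (k + N)) ^ (s : ℝ) :=
            Finset.sum_le_sum fun t _ => ENNReal.rpow_le_rpow (cov_diam t) hs'.le
        _ = f (k + N) := by
          simp only [f]
          rw [ENNReal.ofReal_rpow_of_pos (by positivity), ENNReal.ofReal_mul (by positivity)]
          simp only [Finset.sum_const, Finset.card_univ, Fintype.card_fun, Fintype.card_fin,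
            nsmul_eq_mul]
          congr 1
          rw [ENNReal.ofReal_pow (by positivity)]
          push_cast
          congr 1
          rw [← ENNReal.ofReal_natCast, ← ENNReal.ofReal_natCast, ← ENNReal.ofReal_one,
            ← ENNReal.ofReal_add, ← ENNReal.ofReal_add] <;> positivity
    rw [nonpos_iff_eq_zero.1 hz]
    exact ENNReal.zero_ne_top
  refine nonpos_iff_eq_zero.1 (ENNReal.le_of_forall_pos_le_add fun ε hε _ => ?_)
  simpa using main ε hε

/-- The set of `x ∈ Λ` with `liminf (log aₙ(x))/(log n) < 1` has Hausdorff
dimension `0`. -/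
theorem dimH_liminf_lt_one :
    dimH {x | x ∈ Lam ∧
        Filter.liminf (fun n : ℕ => ((Real.log (cfA n x) / Real.log n : ℝ) : EReal)) atTop <
          (1 : EReal)} = 0 := by
  have hsub : {x | x ∈ Lam ∧
        Filter.liminf (fun n : ℕ => ((Real.log (cfA n x) / Real.log n : ℝ) : EReal)) atTop <
          (1 : EReal)} ⊆ ⋃ q : {q : ℚ // (q : ℝ) < 1},
        {x | x ∈ Lam ∧ ∃ᶠ n : ℕ in atTop, (cfA n x : ℝ) ≤ (n : ℝ) ^ (max (q.1 : ℝ) (1 / 2))} := by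
    rintro x ⟨hx, hl⟩
    obtain ⟨q, hq1, hq2⟩ := EReal.lt_iff_exists_rat_btwn.1 hl
    refine mem_iUnion.2 ⟨⟨q, by exact_mod_cast hq2⟩, hx, ?_⟩
    have hfr := frequently_lt_of_liminf_lt (by isBoundedDefault) hq1
    refine (hfr.and_eventually (eventually_ge_atTop 2)).mono ?_
    rintro n ⟨hn, hn2⟩
    have hn' : Real.log (cfA n x) / Real.log n < (q : ℝ) := by exact_mod_cast hn
    have hn2' : (2 : ℝ) ≤ n := by exact_mod_cast hn2
    have hlog : 0 < Real.log n := Real.log_pos (by linarith)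
    rw [div_lt_iff₀ hlog] at hn'
    rcases Nat.eq_zero_or_pos (cfA n x) with hz | hp
    · rw [hz]; simp; positivity
    · have hp' : (0 : ℝ) < cfA n x := by exact_mod_cast hp
      rw [← Real.log_le_log_iff hp' (by positivity), Real.log_rpow (by linarith)]
      exact hn'.le.trans (by gcongr; exact le_max_left _ _)
  refine nonpos_iff_eq_zero.1 ((dimH_mono hsub).trans ?_)
  rw [dimH_iUnion]
  refine iSup_le fun q => ?_
  rw [dim_aux (lt_of_lt_of_le (by norm_num) (le_max_right _ _)) (max_lt q.2 (by norm_num))]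
end

section
/- Let ψ : ℕ → ℝ⁺ with ψ(n)/log n → ∞ as n → ∞, and define log A = liminf_{n→∞} (log ψ(n))/n (with A ∈ [1,∞]). Then the set F(Λ,ψ) = {x ∈ Λ : a_n(x) ≥ 2^{ψ(n)} for infinitely many n} has Hausdorff dimension 1/(A+1). -/
open Filter MeasureTheory Set
open scoped ENNReal

/-- `T^n x`, all in `(0,1)`. -/
def CFGood (x : ℝ) : Prop := ∀ n, gaussMap^[n] x ∈ Set.Ioo (0:ℝ) 1

theorem gauss_range (x : ℝ) : gaussMap x ∈ Set.Ico (0:ℝ) 1 :=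
  ⟨Int.fract_nonneg _, Int.fract_lt_one _⟩

theorem CFGood.rec_eq {x : ℝ} (h : CFGood x) (n : ℕ) :
    gaussMap^[n] x = 1 / (cfA (n + 1) x + gaussMap^[n + 1] x) ∧ 1 ≤ cfA (n + 1) x := by
  obtain ⟨h0, h1⟩ := h n
  have e : (gaussMap^[n + 1] x) = Int.fract (gaussMap^[n] x)⁻¹ := by
    rw [Function.iterate_succ_apply']; rfl
  have e2 : ((cfA (n + 1) x : ℕ) : ℝ) = ((⌊(gaussMap^[n] x)⁻¹⌋ : ℤ) : ℝ) := by
    simp only [cfA, Nat.add_sub_cancel]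
    exact natCast_floor_eq_intCast_floor (by positivity)
  constructor
  · rw [e, e2, Int.floor_add_fract]; simp
  · simp only [cfA, Nat.add_sub_cancel]
    rw [Nat.one_le_floor_iff]
    exact (one_le_inv₀ h0).2 h1.le

theorem Lam_mono {x : ℝ} (h : x ∈ Lam) : Monotone (fun n => cfA (n + 1) x) :=
  monotone_nat_of_le_succ (fun n => h.2 (n + 1) (by omega))

theorem Lam_good {x : ℝ} (h : x ∈ Lam) : CFGood x := by
  have h1 : 1 ≤ cfA 1 x := by
    simp only [cfA, Nat.sub_self, Function.iterate_zero, id]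
    rw [Nat.one_le_floor_iff]
    exact (one_le_inv₀ h.1.1).2 h.1.2.le
  intro n
  have h2 : 1 ≤ cfA (n + 1) x := h1.trans (Lam_mono h (Nat.zero_le n))
  have h3 : gaussMap^[n] x ∈ Set.Ico (0:ℝ) 1 := by
    cases n with
    | zero => exact ⟨h.1.1.le, h.1.2⟩
    | succ k => rw [Function.iterate_succ_apply']; exact gauss_range _
  refine ⟨lt_of_le_of_ne h3.1 ?_, h3.2⟩
  intro h0
  simp only [cfA, Nat.add_sub_cancel, ← h0] at h2
  simp at h2

theorem step_eq {a p q : ℝ} (ha : 1 ≤ a) (hp : 0 < p) (hq : 0 < q) :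
    |1 / (a + p) - 1 / (a + q)| = |p - q| / ((a + p) * (a + q)) := by
  rw [div_sub_div _ _ (by positivity) (by positivity), abs_div,
    abs_of_pos (a := (a + p) * (a + q)) (by positivity), abs_sub_comm p q]
  congr 2; ring

theorem contr_upper {x y : ℝ} (hx : CFGood x) (hy : CFGood y) (n : ℕ)
    (h : ∀ i < n, cfA (i + 1) x = cfA (i + 1) y) :
    |x - y| ≤ |gaussMap^[n] x - gaussMap^[n] y| *
      ∏ i ∈ Finset.range n, ((cfA (i + 1) x : ℝ) ^ 2)⁻¹ := by
  induction n with
  | zero => simp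
  | succ n ih =>
    refine (ih fun i hi => h i (by omega)).trans ?_
    rw [Finset.prod_range_succ, mul_comm (∏ i ∈ _, _), ← mul_assoc]
    refine mul_le_mul_of_nonneg_right ?_ (Finset.prod_nonneg fun i _ => by positivity)
    · have h1 : (1:ℝ) ≤ cfA (n + 1) x := by exact_mod_cast (hx.rec_eq n).2
      have hp := (hx (n + 1)).1
      have hq := (hy (n + 1)).1
      rw [(hx.rec_eq n).1, (hy.rec_eq n).1, ← h n (by omega), step_eq h1 hp hq, div_eq_mul_inv]
      gcongr
      nlinarith

theorem contr_lower {x y : ℝ} (hx : CFGood x) (hy : CFGood y) (n : ℕ)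
    (h : ∀ i < n, cfA (i + 1) x = cfA (i + 1) y) :
    |gaussMap^[n] x - gaussMap^[n] y| *
      ∏ i ∈ Finset.range n, ((cfA (i + 1) x + 1 : ℝ) ^ 2)⁻¹ ≤ |x - y| := by
  induction n with
  | zero => simp
  | succ n ih =>
    refine le_trans ?_ (ih fun i hi => h i (by omega))
    rw [Finset.prod_range_succ, mul_comm (∏ i ∈ _, _), ← mul_assoc]
    refine mul_le_mul_of_nonneg_right ?_ (Finset.prod_nonneg fun i _ => by positivity)
    · have h1 : (1:ℝ) ≤ cfA (n + 1) x := by exact_mod_cast (hx.rec_eq n).2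
      have hp := (hx (n + 1))
      have hq := (hy (n + 1))
      have hp1 := hp.1
      have hp2 := hp.2
      have hq1 := hq.1
      have hq2 := hq.2
      rw [(hx.rec_eq n).1, (hy.rec_eq n).1, ← h n (by omega), step_eq h1 hp.1 hq.1, div_eq_mul_inv]
      gcongr
      rw [sq]
      gcongr

theorem exists_cf (a : ℕ → ℕ) (ha : ∀ n, 1 ≤ a n) :
    ∃ x, CFGood x ∧ ∀ n, cfA (n + 1) x = a n := by
  let C : ℕ → Set (ℕ → ℝ) := fun N =>
    {y | (∀ n, y n ∈ Set.Icc (0:ℝ) 1) ∧ ∀ n < N, y n * (a n + y (n + 1)) = 1}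
  have hcl : ∀ N, IsClosed (C N) := by
    intro N
    have : C N = (⋂ n, {y : ℕ → ℝ | y n ∈ Set.Icc (0:ℝ) 1}) ∩
        ⋂ n, ⋂ (_ : n < N), {y : ℕ → ℝ | y n * (a n + y (n + 1)) = 1} := by
      ext y; simp [C]
    rw [this]
    refine IsClosed.inter (isClosed_iInter fun n => isClosed_Icc.preimage (continuous_apply n))
      (isClosed_iInter fun n => isClosed_iInter fun _ => isClosed_eq ?_ continuous_const)
    fun_prop
  have hcomp : IsCompact (C 0) := by
    have : C 0 = Set.univ.pi (fun _ => Set.Icc (0:ℝ) 1) := by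
      ext y; simp only [C, Set.mem_pi, Set.mem_ofPred_eq, Set.mem_univ, forall_const]; simp
    rw [this]
    exact isCompact_univ_pi fun _ => isCompact_Icc
  have hne : ∀ N, (C N).Nonempty := by
    suffices H : ∀ N (a : ℕ → ℕ), (∀ n, 1 ≤ a n) → ∃ y : ℕ → ℝ,
        (∀ n, y n ∈ Set.Icc (0:ℝ) 1) ∧ ∀ n < N, y n * (a n + y (n + 1)) = 1 from
      fun N => H N a ha
    intro N
    induction N with
    | zero => exact fun a _ => ⟨fun _ => 0, by simp⟩
    | succ N ih =>
      intro a ha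
      obtain ⟨y, hy1, hy2⟩ := ih (fun n => a (n + 1)) (fun n => ha _)
      have h1 : (1:ℝ) ≤ a 0 := by exact_mod_cast ha 0
      have h2 := (hy1 0).1
      refine ⟨fun n => Nat.casesOn n (1 / (a 0 + y 0)) y, ?_, ?_⟩
      · intro n
        cases n with
        | zero =>
          refine ⟨?_, ?_⟩
          · show 0 ≤ 1 / (a 0 + y 0)
            positivity
          show 1 / (a 0 + y 0) ≤ 1
          rw [div_le_one (by positivity)]; linarith
        | succ n => exact hy1 n
      · intro n hn
        cases n with
        | zero => exact one_div_mul_cancel (by positivity)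
        | succ n => exact hy2 n (by omega)
  obtain ⟨y, hy⟩ := IsCompact.nonempty_iInter_of_sequence_nonempty_isCompact_isClosed C
    (fun N y hy => ⟨hy.1, fun n hn => hy.2 n (by omega)⟩) hne hcomp hcl
  rw [Set.mem_iInter] at hy
  have hI : ∀ n, y n ∈ Set.Icc (0:ℝ) 1 := (hy 0).1
  have hr : ∀ n, y n * (a n + y (n + 1)) = 1 := fun n => (hy (n + 1)).2 n (by omega)
  have hpos : ∀ n, 0 < y n := fun n => lt_of_le_of_ne (hI n).1 fun h => by
    have := hr n; rw [← h] at this; simp at this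
  have hinv : ∀ n, (y n)⁻¹ = a n + y (n + 1) := fun n => by
    exact inv_eq_of_mul_eq_one_right (hr n)
  have hlt : ∀ n, y n < 1 := fun n => by
    by_contra h
    have h1 : (1:ℝ) ≤ a n := by exact_mod_cast ha n
    nlinarith [hr n, hpos (n + 1), hpos n]
  have hit : ∀ n, gaussMap^[n] (y 0) = y n := by
    intro n
    induction n with
    | zero => rfl
    | succ n ih =>
      rw [Function.iterate_succ_apply', ih, gaussMap, hinv, Int.fract_natCast_add,
        Int.fract_eq_self.2 ⟨(hpos _).le, hlt _⟩]
  refine ⟨y 0, fun n => by rw [hit]; exact ⟨hpos n, hlt n⟩, fun n => ?_⟩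
  simp only [cfA, Nat.add_sub_cancel, hit, hinv]
  rw [Nat.floor_eq_iff (by have := hpos (n + 1); positivity)]
  exact ⟨by linarith [hpos (n + 1)], by linarith [hlt (n + 1)]⟩

theorem cover_null (s : ℝ) (hs : 0 < s) (S : Set ℝ) (β : ℕ → Type) [∀ n, Countable (β n)]
    (t : ∀ n, β n → Set ℝ) (w : ∀ n, β n → ℝ≥0∞)
    (hd : ∀ n v, Metric.ediam (t n v) ^ s ≤ w n v) (hsum : ∑' n, ∑' v, w n v ≠ ∞)
    (hcov : ∀ x ∈ S, ∃ᶠ n in atTop, ∃ v, x ∈ t n v) :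
    Measure.hausdorffMeasure s S = 0 := by
  have htail := ENNReal.tendsto_sum_nat_add (fun n => ∑' v, w n v) hsum
  have key := Measure.hausdorffMeasure_le_liminf_tsum (X := ℝ) (β := ℕ)
    (ι := fun N => Σ m, β (m + N)) s S (l := atTop)
    (fun N => (∑' m, ∑' v, w (m + N) v) ^ (1 / s)) ?_ (fun N p => t (p.1 + N) p.2) ?_ ?_
  · refine le_antisymm (key.trans ?_) zero_le
    rw [← htail.liminf_eq]
    refine liminf_le_liminf (Eventually.of_forall fun N => ?_)
    rw [ENNReal.tsum_sigma']
    exact ENNReal.tsum_le_tsum fun m => ENNReal.tsum_le_tsum fun v => hd _ _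
  · have := (ENNReal.continuous_rpow_const (y := 1 / s)).tendsto 0 |>.comp htail
    rwa [ENNReal.zero_rpow_of_pos (by positivity)] at this
  · refine Eventually.of_forall fun N p => ?_
    rw [one_div, ENNReal.le_rpow_inv_iff hs]
    refine (hd _ _).trans ?_
    refine (ENNReal.le_tsum (f := fun v => w (p.1 + N) v) p.2).trans ?_
    exact ENNReal.le_tsum (f := fun m => ∑' v, w (m + N) v) p.1
  · refine Eventually.of_forall fun N x hx => ?_
    obtain ⟨n, hn, v, hv⟩ := (frequently_atTop.1 (hcov x hx)) N
    obtain ⟨m, rfl⟩ : ∃ m, n = m + N := ⟨n - N, by omega⟩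
    exact Set.mem_iUnion.2 ⟨⟨m, v⟩, hv⟩

theorem tsum_pi_prod : ∀ (n : ℕ) (f : Fin n → ℕ → ℝ≥0∞),
    ∑' v : Fin n → ℕ, ∏ i, f i (v i) = ∏ i, ∑' k, f i k
  | 0, f => by simp
  | n + 1, f => by
    rw [← (Fin.consEquiv (fun _ : Fin (n + 1) => ℕ)).tsum_eq, ENNReal.tsum_prod',
      Fin.prod_univ_succ, ← tsum_pi_prod n, ← ENNReal.tsum_mul_right]
    refine tsum_congr fun a => ?_
    rw [← ENNReal.tsum_mul_left]
    refine tsum_congr fun v => ?_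
    rw [Fin.prod_univ_succ]
    simp [Fin.consEquiv]

theorem diam_bound (t : Set ℝ) (n : ℕ) (a : Fin n → ℕ) (L s : ℝ) (hs : 0 < s)
    (h : ∀ x ∈ t, CFGood x ∧ (∀ i : Fin n, cfA (i + 1) x = a i) ∧
      gaussMap^[n] x ≤ Real.exp (-L)) :
    Metric.ediam t ^ s ≤ ENNReal.ofReal (Real.exp (-(s * L))) *
      ∏ i, ENNReal.ofReal (Real.exp (-((2 * s) * Real.log (a i)))) := by
  rcases t.eq_empty_or_nonempty with rfl | ⟨x₀, hx₀⟩
  · simp [hs]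
  have ha : ∀ i, 1 ≤ a i := fun i => by
    rw [← (h x₀ hx₀).2.1 i]; exact ((h x₀ hx₀).1.rec_eq i).2
  have hB : Metric.ediam t ≤ ENNReal.ofReal (Real.exp (-L + ∑ i, -(2 * Real.log (a i)))) := by
    refine Metric.ediam_le_of_forall_dist_le fun x hx y hy => ?_
    obtain ⟨gx, ex, bx⟩ := h x hx
    obtain ⟨gy, ey, hby⟩ := h y hy
    rw [Real.dist_eq]
    refine (contr_upper gx gy n fun i hi => (ex ⟨i, hi⟩).trans (ey ⟨i, hi⟩).symm).trans ?_
    rw [Real.exp_add, Real.exp_sum]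
    refine mul_le_mul ?_ (le_of_eq ?_) (Finset.prod_nonneg fun i _ => by positivity)
      (Real.exp_pos _).le
    · rw [abs_le]
      constructor <;> linarith [(gx n).1, (gy n).1]
    · rw [Finset.prod_range]
      refine Finset.prod_congr rfl fun i _ => ?_
      have h1 : (0:ℝ) < a i := by exact_mod_cast ha i
      rw [ex i, Real.exp_neg, two_mul, Real.exp_add, Real.exp_log h1, sq]
  refine (ENNReal.rpow_le_rpow hB hs.le).trans (le_of_eq ?_)
  rw [ENNReal.ofReal_rpow_of_pos (Real.exp_pos _), ← ENNReal.ofReal_prod_of_nonneg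
    (fun i _ => (Real.exp_pos _).le), ← ENNReal.ofReal_mul (Real.exp_pos _).le, ← Real.exp_sum,
    ← Real.exp_add, ← Real.exp_mul]
  congr 2
  rw [add_mul, Finset.sum_mul]
  congr 1
  · ring
  · exact Finset.sum_congr rfl fun i _ => by ring

theorem zsum_ne_top (p : ℝ) (hp : 1 < p) :
    ∑' k : ℕ, ENNReal.ofReal (Real.exp (-(p * Real.log ((k + 1 : ℕ) : ℝ)))) ≠ ∞ := by
  have h := (summable_nat_add_iff 1).2 (Real.summable_nat_rpow_inv.2 hp)
  rw [← ENNReal.ofReal_tsum_of_nonneg (fun n => (Real.exp_pos _).le)]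
  · exact ENNReal.ofReal_ne_top
  · refine h.congr fun k => ?_
    rw [Real.rpow_def_of_pos (by positivity), ← Real.exp_neg]
    congr 2; ring

theorem superexp_summable (c b Z : ℝ) (hc : 0 < c) (hb : 1 < b) (hZ : 0 < Z) :
    Summable (fun n : ℕ => Real.exp (-(c * b ^ n)) * Z ^ n) := by
  have h1 : Tendsto (fun n : ℕ => (n : ℝ) / b ^ n) atTop (nhds 0) := by
    simpa using tendsto_pow_const_div_const_pow_of_one_lt 1 hb
  have h2 := h1.mul_const (Real.log Z + 1)
  rw [zero_mul] at h2
  have h3 := h2.eventually (gt_mem_nhds hc)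
  refine Summable.of_norm_bounded_eventually_nat (g := fun n => Real.exp (-1) ^ n)
    (summable_geometric_of_lt_one (Real.exp_pos _).le (by simp)) ?_
  filter_upwards [h3] with n hn
  have hbn : 0 < b ^ n := by positivity
  rw [Real.norm_of_nonneg (by positivity)]
  have e : Z ^ n = Real.exp (n * Real.log Z) := by
    rw [Real.exp_nat_mul, Real.exp_log hZ]
  rw [e, ← Real.exp_add, ← Real.exp_nat_mul, Real.exp_le_exp]
  have : (n:ℝ) * (Real.log Z + 1) < c * b ^ n := by
    rw [div_mul_eq_mul_div, div_lt_iff₀ hbn] at hn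
    exact hn
  linarith

/-- Existence of record times. -/
theorem exists_record (u : ℕ → ℝ) (hu : ∀ C, ∃ n, C < u n) (N : ℕ) :
    ∃ n ≥ N, 1 ≤ u n ∧ ∀ i < n, u i ≤ u n := by
  classical
  obtain ⟨C, hC⟩ : ∃ C, ∀ i ∈ Finset.range N, u i ≤ C := by
    obtain ⟨C, hC⟩ := ((Finset.range N).image u).bddAbove
    exact ⟨C, fun i hi => hC (by exact_mod_cast Finset.mem_image_of_mem u hi)⟩
  have hex := hu (max C 1)
  have h1 := Nat.find_spec hex
  refine ⟨Nat.find hex, ?_, (le_max_right C 1).trans h1.le, fun i hi => ?_⟩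
  · by_contra hlt
    push Not at hlt
    have := hC _ (Finset.mem_range.2 hlt)
    exact absurd h1 (not_lt.2 (this.trans (le_max_left _ _)))
  · exact (not_lt.1 (Nat.find_min hex hi)).trans h1.le

theorem upper_b (S : Set ℝ) (b c s : ℝ) (hc : 1 < c) (hcb : c < b) (hs : 0 < s)
    (hsc : 1 < s * (c + 1))
    (hS : ∀ x ∈ S, CFGood x ∧ ∃ᶠ n : ℕ in atTop, (2:ℝ) ^ (b ^ n) ≤ (cfA n x : ℝ)) :
    Measure.hausdorffMeasure s S = 0 := by
  obtain ⟨d, hcd, hdb⟩ := exists_between hcb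
  have hd0 : 0 < d := by linarith
  set ε : ℝ := 1 - (c - 1) / (d - 1) with hε
  have hεpos : 0 < ε := by
    rw [hε, sub_pos, div_lt_one (by linarith)]; linarith
  let L : ∀ n, (Fin n → ℕ) → ℝ := fun n v =>
    (c - 1) * ∑ i, Real.log ((v i + 1 : ℕ) : ℝ) + ε * d ^ n
  refine cover_null s hs S (fun n => Fin n → ℕ)
    (fun n v => {x | CFGood x ∧ (∀ i : Fin n, cfA (i + 1) x = v i + 1) ∧
      gaussMap^[n] x ≤ Real.exp (-(L n v))})
    (fun n v => ENNReal.ofReal (Real.exp (-((s * ε) * d ^ n))) *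
      ∏ i, ENNReal.ofReal (Real.exp (-((s * (c + 1)) * Real.log ((v i + 1 : ℕ) : ℝ))))) ?_ ?_ ?_
  · intro n v
    refine (diam_bound _ n (fun i => v i + 1) (L n v) s hs (fun x hx => hx)).trans (le_of_eq ?_)
    rw [← ENNReal.ofReal_prod_of_nonneg (fun i _ => (Real.exp_pos _).le),
      ← ENNReal.ofReal_prod_of_nonneg (fun i _ => (Real.exp_pos _).le),
      ← ENNReal.ofReal_mul (Real.exp_pos _).le, ← ENNReal.ofReal_mul (Real.exp_pos _).le,
      ← Real.exp_sum, ← Real.exp_sum, ← Real.exp_add, ← Real.exp_add]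
    congr 2
    simp only [L, Finset.sum_neg_distrib, ← Finset.mul_sum]
    ring
  · have hZ := zsum_ne_top (s * (c + 1)) hsc
    set Z := ∑' k : ℕ, ENNReal.ofReal (Real.exp (-((s * (c + 1)) * Real.log ((k + 1 : ℕ) : ℝ))))
      with hZdef
    have e : ∀ n, ∑' v : Fin n → ℕ, ENNReal.ofReal (Real.exp (-((s * ε) * d ^ n))) *
        ∏ i, ENNReal.ofReal (Real.exp (-((s * (c + 1)) * Real.log ((v i + 1 : ℕ) : ℝ))))
        = ENNReal.ofReal (Real.exp (-((s * ε) * d ^ n))) * Z ^ n := by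
      intro n
      rw [ENNReal.tsum_mul_left, tsum_pi_prod n (fun _ k =>
        ENNReal.ofReal (Real.exp (-((s * (c + 1)) * Real.log ((k + 1 : ℕ) : ℝ)))))]
      simp [hZdef]
    rw [tsum_congr e]
    have hle : ∀ n, ENNReal.ofReal (Real.exp (-((s * ε) * d ^ n))) * Z ^ n ≤
        ENNReal.ofReal (Real.exp (-((s * ε) * d ^ n)) * (Z.toReal + 1) ^ n) := by
      intro n
      rw [ENNReal.ofReal_mul (Real.exp_pos _).le, ENNReal.ofReal_pow (by positivity)]
      gcongr
      rw [ENNReal.le_ofReal_iff_toReal_le hZ (by positivity)]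
      linarith
    refine ne_top_of_le_ne_top ?_ (ENNReal.tsum_le_tsum hle)
    rw [← ENNReal.ofReal_tsum_of_nonneg (fun n => by positivity)
      (superexp_summable (s * ε) d (Z.toReal + 1) (by positivity) (by linarith) (by positivity))]
    exact ENNReal.ofReal_ne_top
  · intro x hx
    obtain ⟨gx, hfx⟩ := hS x hx
    have hpos : ∀ n, (1:ℝ) ≤ cfA (n + 1) x := fun n => by exact_mod_cast (gx.rec_eq n).2
    have hunb : ∀ C, ∃ n, C < Real.log (cfA (n + 1) x) / d ^ n := by
      intro C
      have h1 : Tendsto (fun n : ℕ => (b / d) ^ n * (Real.log 2)) atTop atTop :=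
        (tendsto_pow_atTop_atTop_of_one_lt ((one_lt_div hd0).2 hdb)).atTop_mul_const
          (Real.log_pos (by norm_num))
      obtain ⟨n, ⟨hn, hC⟩, hn1⟩ := ((hfx.and_eventually (h1.eventually_gt_atTop C)).and_eventually
        (eventually_ge_atTop 1)).exists
      obtain ⟨m, rfl⟩ : ∃ m, n = m + 1 := ⟨n - 1, by omega⟩
      refine ⟨m, hC.trans_le ?_⟩
      have h2 := Real.log_le_log (by positivity) hn
      rw [Real.log_rpow (by norm_num)] at h2
      have h3 : 0 ≤ Real.log (cfA (m + 1) x) := Real.log_nonneg (hpos m)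
      calc (b / d) ^ (m + 1) * Real.log 2 = (b ^ (m + 1) * Real.log 2) / d ^ (m + 1) := by
            rw [div_pow]; ring
        _ ≤ Real.log (cfA (m + 1) x) / d ^ (m + 1) := by gcongr
        _ ≤ Real.log (cfA (m + 1) x) / d ^ m := by
            gcongr
            · linarith
            · omega
    rw [frequently_atTop]
    intro N
    obtain ⟨n, hnN, hn1, hrec⟩ := exists_record _ hunb N
    refine ⟨n, hnN, fun i => cfA (i + 1) x - 1, gx, fun i => ?_, ?_⟩
    · have := (gx.rec_eq i).2
      show cfA (i + 1) x = cfA (i + 1) x - 1 + 1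
      omega
    · have hdn : 0 < d ^ n := by positivity
      have e1 : ∀ i : Fin n, (cfA (i + 1) x - 1 + 1) = cfA (i + 1) x := fun i => by
        have := (gx.rec_eq i).2
        omega
      simp only [L, e1]
      have hA := hpos n
      have hTn : gaussMap^[n] x ≤ Real.exp (-Real.log (cfA (n + 1) x)) := by
        rw [Real.exp_neg, Real.exp_log (by linarith), (gx.rec_eq n).1, one_div]
        have := (gx (n + 1)).1
        gcongr
        linarith
      refine hTn.trans (Real.exp_le_exp.2 (neg_le_neg ?_))
      set u := Real.log (cfA (n + 1) x) / d ^ n with hu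
      have hlog : Real.log (cfA (n + 1) x) = u * d ^ n := by rw [hu]; field_simp
      have hsum : ∑ i : Fin n, Real.log (cfA (i + 1) x) ≤ u * ((d ^ n - 1) / (d - 1)) := by
        rw [← geom_sum_eq (by linarith), Finset.mul_sum, Finset.sum_range]
        refine Finset.sum_le_sum fun i _ => ?_
        have := hrec i i.2
        rwa [div_le_iff₀ (by positivity)] at this
      have hd1 : 0 < d - 1 := by linarith
      calc (c - 1) * ∑ i : Fin n, Real.log (cfA (i + 1) x) + ε * d ^ n
          ≤ (c - 1) * (u * ((d ^ n - 1) / (d - 1))) + ε * (u * d ^ n) := by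
            gcongr
            exact le_mul_of_one_le_left hdn.le hn1
        _ ≤ (c - 1) * (u * (d ^ n / (d - 1))) + ε * (u * d ^ n) := by
            gcongr
            linarith
        _ = u * d ^ n := by rw [hε]; field_simp; ring
        _ = _ := hlog.symm

theorem upper_one (S : Set ℝ) (s : ℝ) (hs : 1 < 2 * s)
    (hS : ∀ x ∈ S, CFGood x ∧ Tendsto (fun n => cfA (n + 1) x) atTop atTop) :
    Measure.hausdorffMeasure s S = 0 := by
  have hs0 : 0 < s := by linarith
  have hZ := zsum_ne_top (2 * s) hs
  let f : ℕ → ℝ≥0∞ := fun k => ENNReal.ofReal (Real.exp (-((2 * s) * Real.log ((k + 1 : ℕ) : ℝ))))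
  obtain ⟨M, hM⟩ := ((ENNReal.tendsto_sum_nat_add f hZ).eventually
    (gt_mem_nhds (show (0:ℝ≥0∞) < 2⁻¹ by simp))).exists
  let T : ℕ → Set ℝ := fun N => {x | CFGood x ∧ ∀ n ≥ N, M < cfA (n + 1) x}
  have hsub : S ⊆ ⋃ N, T N := by
    intro x hx
    obtain ⟨N, hN⟩ := eventually_atTop.1 ((hS x hx).2.eventually_gt_atTop M)
    exact Set.mem_iUnion.2 ⟨N, (hS x hx).1, hN⟩
  refine measure_mono_null hsub (measure_iUnion_null fun N => ?_)
  let sh : ℕ → ℕ := fun i => if i < N then 0 else M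
  refine cover_null s hs0 (T N) (fun n => Fin (N + n) → ℕ)
    (fun n v => {x | CFGood x ∧ (∀ i : Fin (N + n), cfA (i + 1) x = v i + sh i + 1)})
    (fun n v => ∏ i : Fin (N + n), f (v i + sh i)) ?_ ?_ ?_
  · intro n v
    refine (diam_bound _ (N + n) (fun i => v i + sh i + 1) 0 s hs0
      (fun x hx => ⟨hx.1, hx.2, ?_⟩)).trans (le_of_eq ?_)
    · simpa using (hx.1 (N + n)).2.le
    · simp [f]
  · have e : ∀ n, ∑' v : Fin (N + n) → ℕ, ∏ i : Fin (N + n), f (v i + sh i) ≤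
        (∑' k, f k) ^ N * (2:ℝ≥0∞)⁻¹ ^ n := by
      intro n
      rw [tsum_pi_prod (N + n) (fun i k => f (k + sh i)),
        ← Finset.prod_range (fun i => ∑' k, f (k + sh i)), Finset.prod_range_add]
      refine mul_le_mul' ?_ ?_
      · refine (Finset.prod_le_pow_card _ _ _ (fun i hi => ?_)).trans (by simp; rfl)
        simp [sh, Finset.mem_range.1 hi]
      · refine (Finset.prod_le_pow_card _ _ (2:ℝ≥0∞)⁻¹ (fun i hi => ?_)).trans (by simp)
        simpa [sh] using hM.le
    refine ne_top_of_le_ne_top ?_ (ENNReal.tsum_le_tsum e)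
    rw [ENNReal.tsum_mul_left]
    refine ENNReal.mul_ne_top (ENNReal.pow_ne_top hZ) ?_
    rw [ENNReal.tsum_geometric, ENNReal.one_sub_inv_two]
    simp
  · intro x hx
    refine (Eventually.of_forall fun n => ?_).frequently
    refine ⟨fun i => cfA (i + 1) x - sh i - 1, hx.1, fun i => ?_⟩
    have h1 := (hx.1.rec_eq i).2
    have h2 := hx.2 i
    simp only [sh]
    split_ifs with h
    · omega
    · have := h2 (by omega)
      omega

theorem lower_exponent (b s c : ℝ) (hb : 1 < b) (hs : 0 < s) (hsb : s * (b + 1) < 1)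
    (hc : 0 < c) :
    ∃ E : ℝ, ∀ n : ℕ, ∀ k K : ℝ, k ≤ c * b ^ (n + 1) + 1 →
      ∑ i ∈ Finset.range n, c * b ^ (i + 1) ≤ K →
      1 + (1 - s) * k - (K + k) + s * (2 * (K + k) + 2 * n + 3) ≤ E := by
  have hb1 : 0 < b - 1 := by linarith
  have h2s : 0 < 1 - 2 * s := by nlinarith
  set δ : ℝ := c * b * ((1 - 2 * s) / (b - 1) - s) with hδ
  have hδpos : 0 < δ := by
    have : 0 < (1 - 2 * s) / (b - 1) - s := by
      rw [sub_pos, lt_div_iff₀ hb1]; nlinarith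
    positivity
  have hbd : BddAbove (Set.range fun n : ℕ => 2 * s * n - δ * b ^ n) := by
    refine Filter.IsBoundedUnder.bddAbove_range ⟨0, ?_⟩
    rw [eventually_map]
    have h1 : Tendsto (fun n : ℕ => (n : ℝ) / b ^ n) atTop (nhds 0) := by
      simpa using tendsto_pow_const_div_const_pow_of_one_lt 1 hb
    have h2 := (h1.const_mul (2 * s)).eventually
      (gt_mem_nhds (show 2 * s * 0 < δ by simpa using hδpos))
    filter_upwards [h2] with n hn
    have hbn : 0 < b ^ n := by positivity
    rw [← mul_div_assoc, div_lt_iff₀ hbn] at hn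
    linarith
  obtain ⟨E, hE⟩ := hbd
  refine ⟨E + 1 + s + 3 * s + (1 - 2 * s) * (c * b / (b - 1)), fun n k K hk hK => ?_⟩
  have hEn : 2 * s * n - δ * b ^ n ≤ E := hE ⟨n, rfl⟩
  have hgeo : ∑ i ∈ Finset.range n, c * b ^ (i + 1) = c * b * ((b ^ n - 1) / (b - 1)) := by
    rw [← geom_sum_eq (by linarith), Finset.mul_sum]
    exact Finset.sum_congr rfl fun i _ => by ring
  rw [hgeo] at hK
  have h1 : s * k ≤ s * (c * b ^ (n + 1) + 1) := by gcongr
  have h2 : (1 - 2 * s) * (c * b * ((b ^ n - 1) / (b - 1))) ≤ (1 - 2 * s) * K := by gcongr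
  have h3 : (1 - 2 * s) * (c * b * ((b ^ n - 1) / (b - 1))) - s * (c * b ^ (n + 1)) =
      δ * b ^ n - (1 - 2 * s) * (c * b / (b - 1)) := by
    rw [hδ, pow_succ]; field_simp; ring
  linarith

theorem floor_digit (k K : ℕ) (t : ℝ) (ht : 0 ≤ t) :
    2 ^ k * ⌊2 ^ K * t⌋₊ ≤ ⌊2 ^ (K + k) * t⌋₊ ∧
    ⌊2 ^ (K + k) * t⌋₊ < 2 ^ k * ⌊2 ^ K * t⌋₊ + 2 ^ k := by
  have h1 := Nat.floor_le (show 0 ≤ 2 ^ K * t by positivity)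
  have h2 := Nat.lt_floor_add_one (2 ^ K * t)
  have e : (2:ℝ) ^ (K + k) * t = 2 ^ k * (2 ^ K * t) := by rw [pow_add]; ring
  have hk : (0:ℝ) < 2 ^ k := by positivity
  constructor
  · refine Nat.le_floor ?_
    push_cast
    rw [e]
    gcongr
  · rw [Nat.floor_lt (by positivity)]
    push_cast
    rw [e]
    nlinarith

theorem sep_first {p q d d' Q : ℝ} (hp : 0 < p) (hq : 0 < q) (hp2 : p ≤ 1 / 2) (hq2 : q ≤ 1 / 2)
    (hd : 1 ≤ d) (hd' : 1 ≤ d') (hdQ : d + 1 ≤ Q) (hdQ' : d' + 1 ≤ Q) (hne : 1 ≤ |d - d'|) :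
    |d - d'| / 2 / (Q * Q) ≤ |1 / (d + p) - 1 / (d' + q)| := by
  rw [div_sub_div _ _ (by positivity) (by positivity), abs_div,
    abs_of_pos (a := (d + p) * (d' + q)) (by positivity)]
  have h1 : |d - d'| / 2 ≤ |1 * (d' + q) - (d + p) * 1| := by
    rcases le_or_gt 0 (d - d') with h | h
    · rw [abs_of_nonneg h] at *
      rw [abs_sub_comm]
      refine le_trans ?_ (le_abs_self _)
      linarith
    · rw [abs_of_neg h] at *
      refine le_trans ?_ (le_abs_self _)
      linarith
  gcongr <;> linarith

theorem lower_b (b s : ℝ) (hb : 1 < b) (hs : 0 < s) (hsb : s * (b + 1) < 1) (S : Set ℝ)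
    (hS : ∀ x ∈ Lam, (∀ n, (2:ℝ) ^ (b ^ (n + 1)) ≤ cfA (n + 1) x) → x ∈ S) :
    ENNReal.ofReal s ≤ dimH S := by
  have hb1 : 0 < b - 1 := by linarith
  set c : ℝ := max 1 (1 / (b - 1)) with hc
  have hc1 : 1 ≤ c := le_max_left _ _
  have hc2 : 1 ≤ c * (b - 1) := by
    rw [← div_le_iff₀ hb1]; exact le_max_right _ _
  obtain ⟨E, hE⟩ := lower_exponent b s c hb hs hsb (by linarith)
  let k : ℕ → ℕ := fun n => ⌈c * b ^ (n + 1)⌉₊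
  have hkle : ∀ n, (k n : ℝ) ≤ c * b ^ (n + 1) + 1 := fun n =>
    (Nat.ceil_lt_add_one (by positivity)).le
  have hkge : ∀ n, c * b ^ (n + 1) ≤ k n := fun n => Nat.le_ceil _
  have hpow : ∀ n : ℕ, 1 ≤ b ^ n := fun n => one_le_pow₀ hb.le
  have hkmono : ∀ n, k n + 1 ≤ k (n + 1) := by
    intro n
    have : (k n : ℝ) < k (n + 1) := by
      calc (k n : ℝ) < c * b ^ (n + 1) + 1 := Nat.ceil_lt_add_one (by positivity)
        _ ≤ c * b ^ (n + 1) + (c * (b - 1)) * b ^ (n + 1) := by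
            nlinarith [hpow (n + 1)]
        _ = c * b ^ (n + 1 + 1) := by ring
        _ ≤ _ := hkge _
    exact_mod_cast this
  have hk1 : ∀ n, 1 ≤ k n := fun n => by
    have : (1:ℝ) ≤ k n := by nlinarith [hkge n, hpow (n + 1)]
    exact_mod_cast this
  let K : ℕ → ℕ := fun n => ∑ i ∈ Finset.range n, k i
  have hKs : ∀ n, K (n + 1) = K n + k n := fun n => Finset.sum_range_succ _ _
  have hKn : ∀ n, n ≤ K n := by
    intro n
    induction n with
    | zero => simp
    | succ n ih => rw [hKs]; have := hk1 n; omega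
  let m : ℝ → ℕ → ℕ := fun t n => ⌊(2:ℝ) ^ (K n) * t⌋₊
  let a : ℝ → ℕ → ℕ := fun t n => 2 ^ k n + (m t (n + 1) - 2 ^ k n * m t n)
  have hdig : ∀ t, 0 ≤ t → ∀ n, 2 ^ k n * m t n ≤ m t (n + 1) ∧
      m t (n + 1) < 2 ^ k n * m t n + 2 ^ k n := by
    intro t ht n
    have := floor_digit (k n) (K n) t ht
    rw [← hKs] at this
    exact this
  have ha1 : ∀ t n, 2 ^ k n ≤ a t n := fun t n => Nat.le_add_right _ _
  have ha2 : ∀ t, 0 ≤ t → ∀ n, a t n + 1 ≤ 2 ^ (k n + 1) := by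
    intro t ht n
    have := hdig t ht n
    simp only [a, pow_succ]
    omega
  have hex : ∀ t, ∃ x, CFGood x ∧ ∀ n, cfA (n + 1) x = a t n := fun t =>
    exists_cf (a t) fun n => Nat.one_le_two_pow.trans (ha1 t n)
  choose g hg1 hg2 using hex
  have hgS : ∀ t ∈ Set.Ico (0:ℝ) 1, g t ∈ S := by
    intro t ht
    refine hS _ ⟨hg1 t 0, fun n hn => ?_⟩ fun n => ?_
    · obtain ⟨j, rfl⟩ : ∃ j, n = j + 1 := ⟨n - 1, by omega⟩
      rw [hg2, hg2]
      have h1 := ha2 t ht.1 j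
      have h2 := ha1 t (j + 1)
      have h3 : 2 ^ (k j + 1) ≤ 2 ^ (k (j + 1)) := Nat.pow_le_pow_right (by norm_num) (hkmono j)
      omega
    · rw [hg2]
      have h1 : ((2:ℝ) ^ k n) ≤ a t n := by exact_mod_cast ha1 t n
      refine le_trans ?_ h1
      rw [← Real.rpow_natCast 2 (k n)]
      refine Real.rpow_le_rpow_of_exponent_le (by norm_num) (le_trans ?_ (hkge n))
      nlinarith [hpow (n + 1)]
  have key : ∀ t ∈ Set.Ico (0:ℝ) 1, ∀ t' ∈ Set.Ico (0:ℝ) 1,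
      |t - t'| ≤ (2:ℝ) ^ E * |g t - g t'| ^ s := by
    intro t ht t' ht'
    rcases eq_or_ne t t' with rfl | hne
    · simp [hs.ne']
    have hm0 : ∀ t ∈ Set.Ico (0:ℝ) 1, m t 0 = 0 := by
      intro t ht
      simp only [m, K, Finset.range_zero, Finset.sum_empty, pow_zero, one_mul]
      exact Nat.floor_eq_zero.2 ht.2
    have hfl : ∀ n, |t - t'| * 2 ^ K n ≤ |(m t n : ℝ) - m t' n| + 1 := by
      intro n
      have h1 := Nat.floor_le (show 0 ≤ (2:ℝ) ^ K n * t by have := ht.1; positivity)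
      have h2 := Nat.lt_floor_add_one ((2:ℝ) ^ K n * t)
      have h3 := Nat.floor_le (show 0 ≤ (2:ℝ) ^ K n * t' by have := ht'.1; positivity)
      have h4 := Nat.lt_floor_add_one ((2:ℝ) ^ K n * t')
      have e : |t - t'| * 2 ^ K n = |2 ^ K n * t - 2 ^ K n * t'| := by
        rw [← mul_sub, abs_mul, abs_of_pos (a := (2:ℝ) ^ K n) (by positivity), mul_comm]
      rw [e, abs_le]
      have h5 := le_abs_self ((m t n : ℝ) - m t' n)
      have h6 := neg_abs_le ((m t n : ℝ) - m t' n)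
      simp only [m] at *
      constructor <;> linarith
    have hexn : ∃ n, m t n ≠ m t' n := by
      by_contra hall
      push Not at hall
      have hpos : 0 < |t - t'| := abs_pos.2 (sub_ne_zero.2 hne)
      obtain ⟨n, hn⟩ := pow_unbounded_of_one_lt (1 / |t - t'|) (one_lt_two (α := ℝ))
      have h1 := hfl n
      rw [hall n, sub_self, abs_zero, zero_add] at h1
      rw [div_lt_iff₀ hpos] at hn
      have h2 : (2:ℝ) ^ n ≤ 2 ^ K n := pow_le_pow_right₀ (by norm_num) (hKn n)
      nlinarith
    classical
    obtain ⟨n, hn⟩ : ∃ n, Nat.find hexn = n + 1 := by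
      refine Nat.exists_eq_succ_of_ne_zero fun h0 => ?_
      have := Nat.find_spec hexn
      rw [h0, hm0 t ht, hm0 t' ht'] at this
      exact this rfl
    have hdiff : m t (n + 1) ≠ m t' (n + 1) := hn ▸ Nat.find_spec hexn
    have hsame : ∀ i ≤ n, m t i = m t' i := fun i hi => by
      have := Nat.find_min hexn (m := i) (by omega)
      push Not at this
      exact this
    have hasame : ∀ i < n, a t i = a t' i := fun i hi => by
      simp only [a]
      rw [hsame i (by omega), hsame (i + 1) (by omega)]
    have hd1 := hdig t ht.1 n
    have hd2 := hdig t' ht'.1 n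
    have hDeq : (a t n : ℝ) - a t' n = (m t (n + 1) : ℝ) - m t' (n + 1) := by
      have : (a t n : ℤ) - a t' n = (m t (n + 1) : ℤ) - m t' (n + 1) := by
        simp only [a]
        rw [hsame n le_rfl] at hd1 ⊢
        omega
      exact_mod_cast this
    set D : ℝ := |(a t n : ℝ) - a t' n| with hD
    have hD1 : 1 ≤ D := by
      rw [hD, hDeq]
      have : (1:ℤ) ≤ |(m t (n + 1) : ℤ) - m t' (n + 1)| :=
        Int.one_le_abs (sub_ne_zero.2 (by exact_mod_cast hdiff))
      exact_mod_cast this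
    have hD2 : D ≤ 2 ^ k n := by
      rw [hD, abs_le]
      have h1 : (2:ℝ) ^ k n ≤ a t n := by exact_mod_cast ha1 t n
      have h2 : (2:ℝ) ^ k n ≤ a t' n := by exact_mod_cast ha1 t' n
      have h3 : (a t n : ℝ) + 1 ≤ 2 ^ (k n + 1) := by exact_mod_cast ha2 t ht.1 n
      have h4 : (a t' n : ℝ) + 1 ≤ 2 ^ (k n + 1) := by exact_mod_cast ha2 t' ht'.1 n
      rw [pow_succ] at h3 h4
      constructor <;> linarith
    have hup : |t - t'| * 2 ^ K (n + 1) ≤ 2 * D := by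
      have := hfl (n + 1)
      rw [← hDeq] at this
      linarith
    have half : ∀ t, gaussMap^[n + 1] (g t) ≤ 1 / 2 := by
      intro t
      have h1 : (2:ℝ) ≤ a t (n + 1) := by
        have h2 : 2 ^ 1 ≤ 2 ^ k (n + 1) := Nat.pow_le_pow_right (by norm_num) (hk1 _)
        have h3 := ha1 t (n + 1)
        exact_mod_cast (by omega : 2 ≤ a t (n + 1))
      have h4 := (hg1 t (n + 1 + 1)).1
      rw [((hg1 t).rec_eq (n + 1)).1, hg2]
      gcongr
      linarith
    have hlow := contr_lower (hg1 t) (hg1 t') n (fun i hi => by rw [hg2, hg2, hasame i hi])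
    have hprod : ((2:ℝ) ^ (2 * (K n + n)))⁻¹ ≤
        ∏ i ∈ Finset.range n, ((cfA (i + 1) (g t) + 1 : ℝ) ^ 2)⁻¹ := by
      have e : ((2:ℝ) ^ (2 * (K n + n)))⁻¹ = ∏ i ∈ Finset.range n, (((2:ℝ) ^ (k i + 1)) ^ 2)⁻¹ := by
        rw [Finset.prod_inv_distrib, Finset.prod_pow, Finset.prod_pow_eq_pow_sum,
          Finset.sum_add_distrib, ← pow_mul]
        simp [K, mul_comm]
      rw [e]
      refine Finset.prod_le_prod (fun i _ => by positivity) fun i _ => ?_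
      rw [hg2]
      have : (a t i : ℝ) + 1 ≤ 2 ^ (k i + 1) := by exact_mod_cast ha2 t ht.1 i
      gcongr
    have hone : ∀ t, (1:ℝ) ≤ a t n := fun t => by
      exact_mod_cast Nat.one_le_two_pow.trans (ha1 t n)
    have hfirst := sep_first (hg1 t (n + 1)).1 (hg1 t' (n + 1)).1 (half t) (half t')
      (hone t) (hone t') (Q := 2 ^ (k n + 1))
      (by exact_mod_cast ha2 t ht.1 n) (by exact_mod_cast ha2 t' ht'.1 n) hD1
    rw [((hg1 t).rec_eq n).1, ((hg1 t').rec_eq n).1, hg2, hg2] at hlow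
    have hdist : D * ((2:ℝ) ^ (2 * K (n + 1) + 2 * n + 3))⁻¹ ≤ |g t - g t'| := by
      refine le_trans ?_ hlow
      refine le_trans (le_of_eq ?_) (mul_le_mul hfirst hprod (by positivity) (abs_nonneg _))
      rw [hKs]
      rw [← hD]
      have : (2:ℝ) ^ (2 * (K n + k n) + 2 * n + 3) =
          2 * (2 ^ (k n + 1) * 2 ^ (k n + 1)) * 2 ^ (2 * (K n + n)) := by ring
      rw [this]
      field_simp
    have hD0 : 0 < D := by linarith
    have hlog2 : 0 < Real.log 2 := Real.log_pos (by norm_num)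
    calc |t - t'| ≤ 2 * D * ((2:ℝ) ^ K (n + 1))⁻¹ := by
          rw [← div_eq_mul_inv, le_div_iff₀ (by positivity)]; exact hup
      _ = D ^ s * (2 * D ^ (1 - s) * ((2:ℝ) ^ K (n + 1))⁻¹) := by
          have : D = D ^ s * D ^ (1 - s) := by
            rw [← Real.rpow_add hD0]; simp
          nth_rewrite 1 [this]; ring
      _ ≤ D ^ s * (2 * ((2:ℝ) ^ (k n)) ^ (1 - s) * ((2:ℝ) ^ K (n + 1))⁻¹) := by
          have : 0 ≤ 1 - s := by nlinarith
          gcongr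
      _ = D ^ s * (2:ℝ) ^ (1 + (1 - s) * k n - K (n + 1)) := by
          rw [Real.rpow_sub two_pos, Real.rpow_add two_pos, Real.rpow_one, mul_comm (1 - s),
            Real.rpow_mul two_pos.le, Real.rpow_natCast, Real.rpow_natCast, div_eq_mul_inv]
      _ ≤ D ^ s * ((2:ℝ) ^ E * (2:ℝ) ^ (-(s * (2 * K (n + 1) + 2 * n + 3)))) := by
          rw [← Real.rpow_add two_pos]
          refine mul_le_mul_of_nonneg_left ?_ (by positivity)
          refine Real.rpow_le_rpow_of_exponent_le one_le_two ?_
          have h1 := hE n (k n) (K n) (hkle n) (by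
            simp only [K]; push_cast
            exact Finset.sum_le_sum fun i _ => hkge i)
          have h2 : (K (n + 1) : ℝ) = K n + k n := by exact_mod_cast hKs n
          rw [h2]
          linarith
      _ = (2:ℝ) ^ E * (D * ((2:ℝ) ^ (2 * K (n + 1) + 2 * n + 3))⁻¹) ^ s := by
          rw [Real.mul_rpow hD0.le (by positivity), Real.inv_rpow (by positivity),
            ← Real.rpow_natCast, ← Real.rpow_mul two_pos.le, ← Real.rpow_neg two_pos.le]
          push_cast
          rw [mul_comm s]
          ring
      _ ≤ (2:ℝ) ^ E * |g t - g t'| ^ s := by gcongr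
  have hinj : Set.InjOn g (Set.Ico (0:ℝ) 1) := by
    intro t ht t' ht' h
    have := key t ht t' ht'
    rw [h, sub_self, abs_zero, Real.zero_rpow hs.ne', mul_zero] at this
    exact sub_eq_zero.1 (abs_eq_zero.1 (le_antisymm this (abs_nonneg _)))
  have hleft := hinj.leftInvOn_invFunOn
  set f := Function.invFunOn g (Set.Ico (0:ℝ) 1)
  have hHol : HolderOnWith (Real.toNNReal ((2:ℝ) ^ E)) (Real.toNNReal s) f
      (g '' Set.Ico (0:ℝ) 1) := by
    rintro _ ⟨t, ht, rfl⟩ _ ⟨t', ht', rfl⟩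
    rw [hleft ht, hleft ht', edist_dist, edist_dist, Real.dist_eq, Real.dist_eq,
      Real.coe_toNNReal _ hs.le, ENNReal.ofReal_rpow_of_nonneg (abs_nonneg _) hs.le]
    change _ ≤ ENNReal.ofReal _ * _
    rw [← ENNReal.ofReal_mul (by positivity)]
    exact ENNReal.ofReal_le_ofReal (key t ht t' ht')
  have hdim := hHol.dimH_image_le (Real.toNNReal_pos.2 hs)
  rw [hleft.image_image] at hdim
  have h1 : dimH (Set.Ico (0:ℝ) 1) = 1 := by
    rw [Real.dimH_of_nonempty_interior (by rw [interior_Ico]; exact ⟨1/2, by norm_num, by norm_num⟩)]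
    simp
  rw [h1] at hdim
  have hmono : dimH (g '' Set.Ico (0:ℝ) 1) ≤ dimH S :=
    dimH_mono (by rintro _ ⟨t, ht, rfl⟩; exact hgS t ht)
  refine le_trans ?_ hmono
  change ((Real.toNNReal s : NNReal) : ℝ≥0∞) ≤ _
  have hs' : ((Real.toNNReal s : NNReal) : ℝ≥0∞) ≠ 0 := by
    simpa using hs
  rwa [ENNReal.le_div_iff_mul_le (Or.inl hs') (Or.inl ENNReal.coe_ne_top), one_mul] at hdim

/-- If `ψ(n)/log n → ∞` and `log A = liminf (log ψ(n))/n` with `A ∈ [1,∞]`, then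
`F(Λ,ψ) = {x ∈ Λ : aₙ(x) ≥ 2^{ψ(n)} i.o.}` has Hausdorff dimension `1/(A+1)`. -/
theorem dimH_F_Lam (ψ : ℕ → ℝ) (hψpos : ∀ n, 0 < ψ n)
    (hψ : Tendsto (fun n : ℕ => ψ n / Real.log n) atTop atTop)
    (A : ℝ≥0∞) (hA1 : 1 ≤ A)
    (hA : ENNReal.log A =
      Filter.liminf (fun n : ℕ => ((Real.log (ψ n) / n : ℝ) : EReal)) atTop) :
    dimH {x | x ∈ Lam ∧ ∃ᶠ n : ℕ in atTop, (2 : ℝ) ^ (ψ n) ≤ (cfA n x : ℝ)} =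
      (A + 1)⁻¹ := by
  set F := {x | x ∈ Lam ∧ ∃ᶠ n : ℕ in atTop, (2 : ℝ) ^ (ψ n) ≤ (cfA n x : ℝ)} with hF
  apply le_antisymm
  · by_contra hlt
    push Not at hlt
    obtain ⟨s, hs1, hs2⟩ := ENNReal.lt_iff_exists_nnreal_btwn.1 hlt
    have hs0 : (0 : ℝ) < s := by
      have : (0 : ℝ≥0∞) < s := lt_of_le_of_lt zero_le hs1
      exact_mod_cast this
    have htop := hausdorffMeasure_of_lt_dimH hs2
    suffices h0 : Measure.hausdorffMeasure (s : ℝ) F = 0 by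
      rw [h0] at htop; exact ENNReal.zero_ne_top htop
    rcases hA1.eq_or_lt with rfl | hA1
    · refine upper_one F s ?_ fun x hx => ⟨Lam_good hx.1, ?_⟩
      · have h2 : (1 : ℝ≥0∞) < (1 + 1) * s := by
          have := ENNReal.mul_lt_mul_right (a := 1 + 1) (by simp) (by simp) hs1
          rwa [ENNReal.mul_inv_cancel (by simp) (by simp)] at this
        have h3 : (1 : NNReal) < (1 + 1) * s := by exact_mod_cast h2
        have h4 : (1 : ℝ) < (1 + 1) * s := by exact_mod_cast h3
        linarith
      · refine tendsto_atTop_atTop_of_monotone (Lam_mono hx.1) fun M => ?_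
        have e1 : ∀ᶠ n : ℕ in atTop, (M : ℝ) ≤ Real.log n :=
          (Real.tendsto_log_atTop.comp tendsto_natCast_atTop_atTop).eventually_ge_atTop _
        have e2 := hψ.eventually_ge_atTop 1
        obtain ⟨n, ⟨⟨⟨hn, h1⟩, h2⟩, h3⟩, h4⟩ := ((((hx.2.and_eventually e1).and_eventually
          e2).and_eventually (eventually_ge_atTop 1)).and_eventually
          ((Real.tendsto_log_atTop.comp tendsto_natCast_atTop_atTop).eventually_gt_atTop 0)).exists
        refine ⟨n - 1, ?_⟩
        rw [show n - 1 + 1 = n by omega]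
        have h4' : 0 < Real.log n := h4
        rw [le_div_iff₀ h4', one_mul] at h2
        have h5 : (M : ℝ) ≤ cfA n x := by
          have h6 : (2:ℝ) ^ (M : ℝ) ≤ 2 ^ (ψ n) :=
            Real.rpow_le_rpow_of_exponent_le one_le_two (h1.trans h2)
          rw [Real.rpow_natCast] at h6
          have h7 : (M : ℝ) ≤ 2 ^ M := by exact_mod_cast Nat.lt_two_pow_self.le
          linarith
        exact_mod_cast h5
    · have hmax : max 1 ((s : ℝ≥0∞)⁻¹ - 1) < A := by
        refine max_lt hA1 ?_
        have h1 : (s : ℝ≥0∞)⁻¹ < A + 1 := by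
          rwa [ENNReal.inv_lt_iff_inv_lt]
        by_contra h
        push Not at h
        exact absurd h1 (not_lt.2 ((add_le_add_left h 1).trans
          (tsub_add_cancel_of_le (by
            by_contra h3
            push Not at h3
            rw [tsub_eq_zero_of_le h3.le] at h
            exact absurd (hA1.trans_le h) (by simp))).le))
      obtain ⟨c, hc1, hcA⟩ := ENNReal.lt_iff_exists_nnreal_btwn.1 hmax
      obtain ⟨b, hcb, hbA⟩ := ENNReal.lt_iff_exists_nnreal_btwn.1 hcA
      have hc1' : (1 : ℝ) < c := by
        have := (le_max_left _ _).trans_lt hc1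
        exact_mod_cast this
      have hcb' : (c : ℝ) < b := by exact_mod_cast hcb
      have hsc : (1 : ℝ) < s * (c + 1) := by
        have h1 := (le_max_right _ _).trans_lt hc1
        have hs0' : s ≠ 0 := by
          rintro rfl; simp at hs0
        have h2 : (s⁻¹ : NNReal) - 1 < c := by
          rw [← ENNReal.coe_inv hs0'] at h1
          exact_mod_cast h1
        have h3 : s⁻¹ < c + 1 := by
          by_contra h
          push Not at h
          exact absurd h2 (not_lt.2 (le_tsub_of_add_le_right h))
        have h4 : (s : ℝ)⁻¹ < c + 1 := by exact_mod_cast h3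
        rwa [inv_lt_iff_one_lt_mul₀' hs0] at h4
      refine upper_b F b c s hc1' hcb' hs0 hsc fun x hx => ⟨Lam_good hx.1, ?_⟩
      have hb0 : (0:ℝ) < b := by linarith
      have hlog : ((Real.log b : ℝ) : EReal) < ENNReal.log A := by
        rw [← ENNReal.log_ofReal_of_pos hb0, ENNReal.ofReal_coe_nnreal]
        exact ENNReal.log_strictMono hbA
      rw [hA] at hlog
      have hev := eventually_lt_of_lt_liminf hlog
      refine (hx.2.and_eventually (hev.and (eventually_ge_atTop 1))).mono ?_
      rintro n ⟨h1, h2, h3⟩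
      refine le_trans ?_ h1
      refine Real.rpow_le_rpow_of_exponent_le one_le_two ?_
      have hn : (0:ℝ) < n := by exact_mod_cast h3
      have h4 : Real.log b < Real.log (ψ n) / n := by exact_mod_cast h2
      rw [lt_div_iff₀ hn, mul_comm, ← Real.log_pow,
        Real.log_lt_log_iff (by positivity) (hψpos n)] at h4
      exact h4.le
  · by_contra hlt
    push Not at hlt
    obtain ⟨s, hs1, hs2⟩ := ENNReal.lt_iff_exists_nnreal_btwn.1 hlt
    have hs0 : (0 : ℝ) < s := by
      have : (0 : ℝ≥0∞) < s := lt_of_le_of_lt zero_le hs1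
      exact_mod_cast this
    have hAtop : A ≠ ∞ := by
      rintro rfl; simp at hs2
    lift A to NNReal using hAtop
    have hA1' : (1:ℝ) ≤ A := by exact_mod_cast hA1
    have hsA : (A : ℝ) < (s : ℝ)⁻¹ - 1 := by
      have h1 : s < (A + 1)⁻¹ := by
        rw [← ENNReal.coe_one, ← ENNReal.coe_add, ← ENNReal.coe_inv (by positivity)] at hs2
        exact_mod_cast hs2
      have h2 : (s : ℝ) < (A + 1 : ℝ)⁻¹ := by exact_mod_cast h1
      rw [lt_inv_comm₀ hs0 (by positivity)] at h2
      linarith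
    obtain ⟨b, hAb, hbs⟩ := exists_between hsA
    have hsb : (s : ℝ) * (b + 1) < 1 := by
      have h1 : b + 1 < (s : ℝ)⁻¹ := by linarith
      rw [lt_inv_comm₀ (by linarith) hs0, lt_inv_comm₀ hs0 (by linarith)] at h1
      calc (s : ℝ) * (b + 1) < s * (s : ℝ)⁻¹ := by gcongr
        _ = 1 := mul_inv_cancel₀ hs0.ne'
    have hfin := lower_b b s (by linarith) hs0 hsb F ?_
    · rw [ENNReal.ofReal_coe_nnreal] at hfin
      exact absurd hs1 (not_lt.2 hfin)
    · intro x hx hall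
      refine ⟨hx, ?_⟩
      have hb0 : (0:ℝ) < b := by linarith
      have hlog : ENNReal.log A < ((Real.log b : ℝ) : EReal) := by
        rw [← ENNReal.log_ofReal_of_pos hb0]
        refine ENNReal.log_strictMono ?_
        rw [ENNReal.lt_ofReal_iff_toReal_lt ENNReal.coe_ne_top]
        simpa using hAb
      rw [hA] at hlog
      have hfr := frequently_lt_of_liminf_lt (by isBoundedDefault) hlog
      refine (hfr.and_eventually (eventually_ge_atTop 1)).mono ?_
      rintro n ⟨h2, h3⟩
      obtain ⟨j, rfl⟩ : ∃ j, n = j + 1 := ⟨n - 1, by omega⟩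
      refine le_trans ?_ (hall j)
      refine Real.rpow_le_rpow_of_exponent_le one_le_two ?_
      have hn : (0:ℝ) < ((j + 1 : ℕ) : ℝ) := by exact_mod_cast h3
      have h4 : Real.log (ψ (j + 1)) / ((j + 1 : ℕ) : ℝ) < Real.log b := by exact_mod_cast h2
      rw [div_lt_iff₀ hn, mul_comm, ← Real.log_pow,
        Real.log_lt_log_iff (hψpos _) (by positivity)] at h4
      exact h4.le
end

section
/- For any a, b > 1, the sets F(Λ,a,b) = {x ∈ Λ : a_n(x) ≥ a^{b^n} for all n ≥ 1} and F̃(Λ,a,b) = {x ∈ Λ : a_n(x) ≥ a^{b^n} for infinitely many n} both have Hausdorff dimension 1/(b+1). -/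
open Filter MeasureTheory Set

lemma cfA_succ (n : ℕ) (x : ℝ) : cfA (n + 1) x = ⌊(gaussMap^[n] x)⁻¹⌋₊ := by
  simp [cfA]

lemma gauss_eq {x : ℝ} {m : ℕ} (hm : 1 ≤ m) (h : ⌊x⁻¹⌋₊ = m) :
    0 < x ∧ (m : ℝ) * x ≤ 1 ∧ 1 < (m + 1 : ℝ) * x ∧ x⁻¹ = m + gaussMap x := by
  have h1 : (m : ℝ) ≤ x⁻¹ := by
    rw [← h]; apply Nat.floor_le
    by_contra hc
    rw [Nat.floor_of_nonpos (by linarith)] at h; omega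
  have h2 : x⁻¹ < (m : ℝ) + 1 := by
    rw [← h]; exact Nat.lt_floor_add_one _
  have hm' : (1 : ℝ) ≤ m := by exact_mod_cast hm
  have hx : 0 < x := by
    have : 0 < x⁻¹ := by linarith
    exact inv_pos.mp this
  have hxx : x⁻¹ * x = 1 := inv_mul_cancel₀ hx.ne'
  refine ⟨hx, by nlinarith, by nlinarith, ?_⟩
  have h3 : ⌊x⁻¹⌋ = (m : ℤ) := by
    rw [Int.floor_eq_iff]; push_cast; exact ⟨h1, h2⟩
  have := Int.floor_add_fract x⁻¹
  rw [h3] at this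
  unfold gaussMap; push_cast at this; linarith

lemma gauss_diff {x y : ℝ} {m : ℕ} (hm : 1 ≤ m) (hx : ⌊x⁻¹⌋₊ = m) (hy : ⌊y⁻¹⌋₊ = m) :
    |x - y| * (m : ℝ) ^ 2 ≤ |gaussMap x - gaussMap y| ∧
    |gaussMap x - gaussMap y| ≤ |x - y| * ((m : ℝ) + 1) ^ 2 := by
  obtain ⟨x0, x1, x2, x3⟩ := gauss_eq hm hx
  obtain ⟨y0, y1, y2, y3⟩ := gauss_eq hm hy
  have hm' : (1 : ℝ) ≤ m := by exact_mod_cast hm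
  have e : |x - y| = x * y * |gaussMap x - gaussMap y| := by
    have : gaussMap x - gaussMap y = x⁻¹ - y⁻¹ := by rw [x3, y3]; ring
    have e2 : y - x = x * y * (x⁻¹ - y⁻¹) := by field_simp
    rw [this, abs_sub_comm, e2, abs_mul, abs_of_pos (mul_pos x0 y0)]
  have h1 : x * y * (m : ℝ) ^ 2 ≤ 1 := by
    have : x * y * (m : ℝ) ^ 2 = (m * x) * (m * y) := by ring
    rw [this]; apply mul_le_one₀ x1 (by positivity) y1
  have h2 : 1 ≤ x * y * ((m : ℝ) + 1) ^ 2 := by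
    have : x * y * ((m : ℝ) + 1) ^ 2 = ((m + 1) * x) * ((m + 1) * y) := by ring
    rw [this]; exact one_le_mul_of_one_le_of_one_le x2.le y2.le
  rw [e]
  have := abs_nonneg (gaussMap x - gaussMap y)
  constructor <;> nlinarith

lemma iter_diff {x y : ℝ} {v : ℕ → ℕ} (n : ℕ) (hv : ∀ i < n, 1 ≤ v i)
    (hx : ∀ i < n, cfA (i + 1) x = v i) (hy : ∀ i < n, cfA (i + 1) y = v i) :
    |x - y| * (∏ i ∈ Finset.range n, (v i : ℝ)) ^ 2 ≤ |gaussMap^[n] x - gaussMap^[n] y| ∧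
    |gaussMap^[n] x - gaussMap^[n] y| ≤
      |x - y| * (∏ i ∈ Finset.range n, ((v i : ℝ) + 1)) ^ 2 := by
  induction n with
  | zero => simp
  | succ n ih =>
    obtain ⟨h1, h2⟩ := ih (fun i hi => hv i (by omega)) (fun i hi => hx i (by omega))
      (fun i hi => hy i (by omega))
    have a1 := hx n (by omega)
    have a2 := hy n (by omega)
    rw [cfA_succ] at a1 a2
    obtain ⟨h3, h4⟩ := gauss_diff (hv n (by omega)) a1 a2
    rw [Function.iterate_succ_apply', Function.iterate_succ_apply', Finset.prod_range_succ,
      Finset.prod_range_succ]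
    constructor
    · refine le_trans ?_ h3
      rw [mul_pow, ← mul_assoc]
      gcongr
    · refine h4.trans ?_
      rw [mul_pow, ← mul_assoc]
      gcongr

lemma Lam_pos {x : ℝ} (hx : x ∈ Lam) (n : ℕ) : 1 ≤ cfA (n + 1) x := by
  induction n with
  | zero =>
    rw [cfA_succ]
    obtain ⟨⟨h0, h1⟩, -⟩ := hx
    simp only [Function.iterate_zero, id]
    rw [Nat.one_le_floor_iff]
    exact (one_le_inv₀ h0).mpr h1.le
  | succ n ih => exact ih.trans (hx.2 (n + 1) (by omega))

/-- cylinder with a large next digit -/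
noncomputable def Jset (c : ℝ) (n : ℕ) (w : Fin n → ℕ) : Set ℝ :=
  {x | (∀ i : Fin n, cfA (i + 1) x = w i + 1) ∧
    (∏ i, ((w i : ℝ) + 1)) ^ (c - 1) ≤ (cfA (n + 1) x : ℝ) ∧
    Real.exp (c ^ (n + 1)) ≤ (cfA (n + 1) x : ℝ)}

lemma Jset_dist {c : ℝ} {n : ℕ} {w : Fin n → ℕ} {δ : ℝ} (h0 : 0 ≤ δ) (h1 : δ ≤ 1)
    {x y : ℝ} (hx : x ∈ Jset c n w) (hy : y ∈ Jset c n w) :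
    |x - y| ≤ (∏ i, ((w i : ℝ) + 1)) ^ (-(2 + (c - 1) * (1 - δ))) *
      Real.exp (-(δ * c ^ (n + 1))) := by
  set P : ℝ := ∏ i, ((w i : ℝ) + 1) with hP
  have Ppos : 0 < P := Finset.prod_pos (fun i _ => by positivity)
  let v : ℕ → ℕ := fun i => if h : i < n then w ⟨i, h⟩ + 1 else 1
  have hvw : ∀ i (h : i < n), v i = w ⟨i, h⟩ + 1 := fun i h => by simp [v, h]
  have hd := (iter_diff (x := x) (y := y) (v := v) n
    (fun i hi => by rw [hvw i hi]; omega)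
    (fun i hi => by rw [hvw i hi]; exact hx.1 ⟨i, hi⟩)
    (fun i hi => by rw [hvw i hi]; exact hy.1 ⟨i, hi⟩)).1
  have hPv : ∏ i ∈ Finset.range n, (v i : ℝ) = P := by
    rw [hP, Finset.prod_range]
    apply Finset.prod_congr rfl
    intro i _
    rw [hvw i i.2]; push_cast; rfl
  rw [hPv] at hd
  -- bound on iterates
  set B : ℝ := P ^ ((c - 1) * (1 - δ)) * Real.exp (δ * c ^ (n + 1)) with hB
  have Bpos : 0 < B := by positivity
  have key : ∀ z ∈ Jset c n w, 0 < gaussMap^[n] z ∧ gaussMap^[n] z ≤ B⁻¹ := by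
    intro z hz
    obtain ⟨-, z1, z2⟩ := hz
    have hc1 : 1 ≤ cfA (n + 1) z := by
      by_contra hc
      have : cfA (n + 1) z = 0 := by omega
      rw [this] at z2
      have := Real.exp_pos (c ^ (n + 1))
      push_cast at z2; linarith
    have hA : B ≤ (cfA (n + 1) z : ℝ) := by
      set A : ℝ := (cfA (n + 1) z : ℝ)
      have Apos : 0 < A := lt_of_lt_of_le (Real.exp_pos _) z2
      have : A = A ^ (1 - δ) * A ^ δ := by
        rw [← Real.rpow_add Apos]; simp
      rw [this, hB, Real.rpow_mul Ppos.le, mul_comm δ, Real.exp_mul]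
      gcongr
    have := gauss_eq hc1 (cfA_succ n z).symm
    refine ⟨this.1, ?_⟩
    rw [le_inv_comm₀ this.1 Bpos]
    refine hA.trans ?_
    rw [← one_div, le_div_iff₀ this.1]; exact this.2.1
  have hx' := key x hx
  have hy' := key y hy
  have h3 : |gaussMap^[n] x - gaussMap^[n] y| ≤ B⁻¹ := by
    rw [abs_le]; constructor <;> linarith
  have e : P ^ (-(2 + (c - 1) * (1 - δ))) * Real.exp (-(δ * c ^ (n + 1))) = B⁻¹ / P ^ 2 := by
    rw [hB, mul_inv, Real.exp_neg, neg_add, Real.rpow_add Ppos, Real.rpow_neg Ppos.le,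
      Real.rpow_neg Ppos.le]
    norm_num
    field_simp
  rw [e, le_div_iff₀ (by positivity)]
  linarith

lemma growth {c b l : ℝ} (hc : 1 < c) (hcb : c < b) (hl : 0 < l) (u : ℕ → ℝ) (hu : ∀ n, 0 ≤ u n)
    (hf : ∃ᶠ n : ℕ in atTop, l * b ^ (n + 1) ≤ u n) :
    ∃ᶠ n : ℕ in atTop, (c - 1) * (∑ i ∈ Finset.range n, u i) ≤ u n ∧ c ^ (n + 1) ≤ u n := by
  by_contra hcon
  rw [not_frequently] at hcon
  obtain ⟨N, hN⟩ := eventually_atTop.mp hcon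
  set L : ℕ → ℝ := fun n => ∑ i ∈ Finset.range n, u i with hL
  have hLs : ∀ n, L (n + 1) = L n + u n := fun n => Finset.sum_range_succ _ _
  set K : ℝ := max (L N / c ^ N) (c / (c - 1)) with hK
  have hc0 : 0 < c := by linarith
  have hK2 : c ≤ K * (c - 1) := by
    have := le_max_right (L N / c ^ N) (c / (c - 1))
    rwa [← hK, div_le_iff₀ (by linarith)] at this
  have hb : ∀ n, N ≤ n → L n ≤ K * c ^ n := by
    intro n hn
    induction n, hn using Nat.le_induction with
    | base =>
      have := le_max_left (L N / c ^ N) (c / (c - 1))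
      rwa [← hK, div_le_iff₀ (by positivity)] at this
    | succ n hn ih =>
      have h := hN n hn
      rw [not_and_or] at h
      rw [hLs]
      have hp : 0 < c ^ n := by positivity
      rcases h with h | h
      · push Not at h
        change u n < (c - 1) * L n at h
        rw [pow_succ]; nlinarith
      · push Not at h
        rw [pow_succ] at h ⊢
        nlinarith
  have hLn : ∀ n, 0 ≤ L n := fun n => Finset.sum_nonneg (fun i _ => hu i)
  have hb0 : 0 < b := by linarith
  have ht : Tendsto (fun n : ℕ => (c / b) ^ (n + 1)) atTop (nhds 0) :=
    (tendsto_pow_atTop_nhds_zero_of_lt_one (by positivity)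
      ((div_lt_one (by linarith)).mpr hcb)).comp (tendsto_add_atTop_nat 1)
  have hKp : 0 < K := by nlinarith
  have hev := ht.eventually (gt_mem_nhds (show 0 < l / K by positivity))
  obtain ⟨n, hn1, hn2, hn3⟩ := (hf.and_eventually (hev.and (eventually_ge_atTop N))).exists
  have h1 := hb (n + 1) (by omega)
  rw [hLs] at h1
  have h2 := hLn n
  rw [div_pow, div_lt_div_iff₀ (by positivity) hKp] at hn2
  nlinarith

lemma tsum_pi (f : ℕ → ENNReal) (n : ℕ) :
    ∑' w : Fin n → ℕ, ∏ i, f (w i) = (∑' k, f k) ^ n := by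
  induction n with
  | zero => simp
  | succ n ih =>
    rw [← (Fin.consEquiv (fun _ : Fin (n + 1) => ℕ)).tsum_eq, ENNReal.tsum_prod', pow_succ', ← ih,
      ← ENNReal.tsum_mul_right]
    congr 1; ext k
    rw [← ENNReal.tsum_mul_left]
    congr 1; ext w
    simp [Fin.consEquiv, Fin.prod_univ_succ]

lemma lin_le_exp (A κ c : ℝ) (hκ : 0 < κ) (hc : 1 < c) :
    ∃ C : ℝ, ∀ n : ℕ, n * A ≤ κ * c ^ n + C := by
  have h := tendsto_pow_const_div_const_pow_of_one_lt 1 hc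
  have h2 := (h.mul_const A).eventually (gt_mem_nhds (show (0 : ℝ) * A < κ by simpa))
  obtain ⟨N, hN⟩ := eventually_atTop.mp h2
  refine ⟨N * |A|, fun n => ?_⟩
  have hp : 0 < c ^ n := pow_pos (by linarith) n
  by_cases hn : N ≤ n
  · have := hN n hn
    rw [pow_one, div_mul_eq_mul_div, div_lt_iff₀ hp] at this
    have : 0 ≤ (N : ℝ) * |A| := by positivity
    linarith
  · have h1 : (n : ℝ) * A ≤ n * |A| := by gcongr; exact le_abs_self A
    have h2 : (n : ℝ) * |A| ≤ N * |A| := by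
      gcongr; omega
    have : 0 < κ * c ^ n := by positivity
    linarith

lemma summable_aux_s15 (z κ c : ℝ) (hz : 0 ≤ z) (hκ : 0 < κ) (hc : 1 < c) :
    Summable (fun n : ℕ => Real.exp (-(κ * c ^ (n + 1))) * z ^ n) := by
  obtain ⟨C, hC⟩ := lin_le_exp (Real.log (z + 1) + 1) κ c hκ hc
  refine Summable.of_nonneg_of_le (fun n => by positivity) (fun n => ?_)
    ((Real.summable_exp_neg_nat).mul_left (Real.exp C))
  have h1 : z ^ n ≤ Real.exp (n * Real.log (z + 1)) := by
    rw [mul_comm, Real.exp_mul, Real.exp_log (by positivity), Real.rpow_natCast]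
    gcongr; linarith
  calc _ ≤ Real.exp (-(κ * c ^ (n + 1))) * Real.exp (n * Real.log (z + 1)) := by gcongr
    _ = Real.exp (-(κ * c ^ (n + 1)) + n * Real.log (z + 1)) := by rw [Real.exp_add]
    _ ≤ Real.exp (C + -n) := by
      apply Real.exp_le_exp.mpr
      have := hC n
      have h3 : κ * c ^ n ≤ κ * c ^ (n + 1) := by
        gcongr
        · exact hc.le
        · omega
      linarith
    _ = _ := by rw [Real.exp_add]

lemma mem_Jset {a b c : ℝ} (ha : 1 < a) (hc : 1 < c) (hcb : c < b) {x : ℝ} (hx : x ∈ Lam)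
    (hf : ∃ᶠ n : ℕ in atTop, a ^ (b ^ n) ≤ (cfA n x : ℝ)) :
    ∃ᶠ n : ℕ in atTop, x ∈ Jset c n (fun i => cfA (i + 1) x - 1) := by
  have hpos : ∀ n, (1 : ℝ) ≤ (cfA (n + 1) x : ℝ) := fun n => by exact_mod_cast Lam_pos hx n
  have hf' : ∃ᶠ n : ℕ in atTop, Real.log a * b ^ (n + 1) ≤ Real.log (cfA (n + 1) x) := by
    rw [frequently_atTop] at hf ⊢
    intro N
    obtain ⟨m, hm, h⟩ := hf (N + 1)
    obtain ⟨n, rfl⟩ : ∃ n, m = n + 1 := ⟨m - 1, by omega⟩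
    refine ⟨n, by omega, ?_⟩
    have := Real.log_le_log (by positivity) h
    rw [Real.log_rpow (by linarith)] at this
    linarith
  have := growth hc hcb (Real.log_pos ha) (fun n => Real.log (cfA (n + 1) x))
    (fun n => Real.log_nonneg (hpos n)) hf'
  refine this.mono ?_
  rintro n ⟨h1, h2⟩
  have h0 : (0 : ℝ) < (cfA (n + 1) x : ℝ) := by linarith [hpos n]
  have hcast : ∀ i : ℕ, (((cfA (i + 1) x - 1 : ℕ) : ℝ) + 1) = (cfA (i + 1) x : ℝ) := by
    intro i
    have := Lam_pos hx i
    rw [Nat.cast_sub this]; simp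
  refine ⟨fun i => ?_, ?_, ?_⟩
  · have := Lam_pos hx i
    change cfA (i + 1) x = (cfA (i + 1) x - 1) + 1
    omega
  · simp only [hcast]
    rw [← Finset.prod_range (fun i => (cfA (i + 1) x : ℝ))]
    have hP : 0 < ∏ i ∈ Finset.range n, (cfA (i + 1) x : ℝ) :=
      Finset.prod_pos (fun i _ => by linarith [hpos i])
    rw [← Real.log_le_log_iff (by positivity) h0, Real.log_rpow hP,
      Real.log_prod (fun i _ => by linarith [hpos i])]
    exact h1
  · rwa [← Real.le_log_iff_exp_le h0]

open NNReal ENNReal in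
lemma upper_bound (a b : ℝ) (ha : 1 < a) (hb : 1 < b) (s : ℝ≥0) (hs : 1 / (b + 1) < s) :
    dimH {x | x ∈ Lam ∧ ∃ᶠ n : ℕ in atTop, a ^ (b ^ n) ≤ (cfA n x : ℝ)} ≤ s := by
  have hs0 : (0 : ℝ) < s := lt_trans (by positivity) hs
  obtain ⟨c, hc1, hc2⟩ : ∃ c, max 1 (1 / (s : ℝ) - 1) < c ∧ c < b := by
    apply exists_between
    rw [max_lt_iff]
    refine ⟨hb, ?_⟩
    rw [sub_lt_iff_lt_add, one_div_lt hs0 (by linarith)]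
    exact hs
  obtain ⟨hc, hc3⟩ := max_lt_iff.mp hc1
  have hsc : 1 < s * (c + 1) := by
    rw [sub_lt_iff_lt_add, div_lt_iff₀ hs0] at hc3
    linarith
  obtain ⟨δ, hδ0, hδ1, hδ⟩ : ∃ δ : ℝ, 0 < δ ∧ δ ≤ 1 ∧ 1 < s * (2 + (c - 1) * (1 - δ)) := by
    have hd : 0 < s * (c - 1) := mul_pos hs0 (by linarith)
    refine ⟨min 1 ((s * (c + 1) - 1) / (2 * (s * (c - 1)))), ?_, min_le_left _ _, ?_⟩
    · rw [lt_min_iff]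
      exact ⟨one_pos, div_pos (by linarith) (by linarith)⟩
    · have h := min_le_right 1 ((s * (c + 1) - 1) / (2 * (s * (c - 1))))
      rw [le_div_iff₀ (by linarith)] at h
      nlinarith
  set τ : ℝ := s * (2 + (c - 1) * (1 - δ)) with hτ
  let κ : ℝ := s * δ
  have hκ : 0 < κ := by positivity
  let g : ℕ → ℝ≥0∞ := fun k => ENNReal.ofReal (((k : ℝ) + 1) ^ (-τ))
  have hZ : ∑' k, g k ≠ ∞ := by
    have : Summable (fun k : ℕ => ((k : ℝ) + 1) ^ (-τ)) := by
      have hlt : -τ < -1 := by linarith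
      have h := Real.summable_nat_rpow.mpr hlt
      have h2 := (summable_nat_add_iff (f := fun n : ℕ => (n : ℝ) ^ (-τ)) 1).mpr h
      simpa using h2
    exact this.tsum_ofReal_ne_top
  let term : (Σ n : ℕ, (Fin n → ℕ)) → ℝ≥0∞ := fun p =>
    ENNReal.ofReal (Real.exp (-(κ * c ^ (p.1 + 1)))) * ∏ i, g (p.2 i)
  have hterm : ∑' p, term p ≠ ∞ := by
    rw [ENNReal.tsum_sigma']
    have : ∀ n : ℕ, ∑' w : Fin n → ℕ, term ⟨n, w⟩ =
        ENNReal.ofReal (Real.exp (-(κ * c ^ (n + 1))) * (∑' k, g k).toReal ^ n) := by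
      intro n
      simp only [term]
      rw [ENNReal.tsum_mul_left, tsum_pi, ENNReal.ofReal_mul (by positivity),
        ENNReal.ofReal_pow ENNReal.toReal_nonneg, ENNReal.ofReal_toReal hZ]
    simp_rw [this]
    exact (summable_aux_s15 _ κ c ENNReal.toReal_nonneg hκ hc).tsum_ofReal_ne_top
  let t : ℕ → (Σ n : ℕ, (Fin n → ℕ)) → Set ℝ := fun N p => if N ≤ p.1 then Jset c p.1 p.2 else ∅
  have hdist : ∀ n (w : Fin n → ℕ), Metric.ediam (Jset c n w) ≤
      ENNReal.ofReal ((∏ i, ((w i : ℝ) + 1)) ^ (-(2 + (c - 1) * (1 - δ))) *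
        Real.exp (-(δ * c ^ (n + 1)))) := by
    intro n w
    apply Metric.ediam_le
    intro x hx y hy
    rw [edist_dist, Real.dist_eq]
    exact ENNReal.ofReal_le_ofReal (Jset_dist hδ0.le hδ1 hx hy)
  apply dimH_le_of_hausdorffMeasure_ne_top
  refine ne_top_of_le_ne_top hterm ?_
  refine (Measure.hausdorffMeasure_le_liminf_tsum (l := atTop) (s : ℝ) _
    (fun N : ℕ => ENNReal.ofReal (Real.exp (-(δ * c ^ (N + 1))))) ?_ t ?_ ?_).trans ?_
  · rw [← ENNReal.ofReal_zero]
    apply ENNReal.tendsto_ofReal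
    apply Real.tendsto_exp_neg_atTop_nhds_zero.comp
    apply Tendsto.const_mul_atTop hδ0
    exact (tendsto_pow_atTop_atTop_of_one_lt hc).comp (tendsto_add_atTop_nat 1)
  · refine Eventually.of_forall (fun N p => ?_)
    simp only [t]
    split_ifs with h
    · refine (hdist p.1 p.2).trans (ENNReal.ofReal_le_ofReal ?_)
      have hP : 1 ≤ ∏ i, ((p.2 i : ℝ) + 1) := by
        have := Finset.prod_le_prod (s := Finset.univ) (f := fun _ : Fin p.1 => (1 : ℝ))
          (g := fun i => (p.2 i : ℝ) + 1) (fun i _ => by norm_num) (fun i _ => by simp)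
        simpa using this
      have h1 : (∏ i, ((p.2 i : ℝ) + 1)) ^ (-(2 + (c - 1) * (1 - δ))) ≤ 1 := by
        apply Real.rpow_le_one_of_one_le_of_nonpos hP
        nlinarith
      have h2 : Real.exp (-(δ * c ^ (p.1 + 1))) ≤ Real.exp (-(δ * c ^ (N + 1))) := by
        apply Real.exp_le_exp.mpr
        apply neg_le_neg
        gcongr
        exact hc.le
      calc _ ≤ 1 * Real.exp (-(δ * c ^ (p.1 + 1))) := by gcongr
        _ ≤ _ := by rw [one_mul]; exact h2
    · simp
  · refine Eventually.of_forall (fun N x hx => ?_)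
    obtain ⟨n, hn, h⟩ := frequently_atTop.mp (mem_Jset ha hc hc2 hx.1 hx.2) N
    rw [mem_iUnion]
    refine ⟨⟨n, fun i => cfA (i + 1) x - 1⟩, ?_⟩
    simp only [t]
    rw [if_pos hn]
    exact h
  · have hb : ∀ N : ℕ, ∑' p, Metric.ediam (t N p) ^ (s : ℝ) ≤ ∑' p, term p := by
      intro N
      apply ENNReal.tsum_le_tsum
      rintro ⟨n, w⟩
      simp only [t]
      split_ifs with h
      · refine (ENNReal.rpow_le_rpow (hdist n w) hs0.le).trans ?_
        have hP : 0 < ∏ i, ((w i : ℝ) + 1) := Finset.prod_pos (fun i _ => by positivity)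
        rw [ENNReal.ofReal_rpow_of_nonneg (by positivity) hs0.le,
          Real.mul_rpow (by positivity) (by positivity), ← Real.rpow_mul hP.le, ← Real.exp_mul,
          mul_comm]
        simp only [term, g]
        rw [← ENNReal.ofReal_prod_of_nonneg (fun i _ => by positivity),
          ← ENNReal.ofReal_mul (by positivity), Real.finsetProd_rpow _ _ (fun i _ => by positivity)]
        apply le_of_eq
        congr 2
        · congr 1; simp only [κ]; ring
        · congr 1; rw [hτ]; ring
      · simp [hs0]
    calc _ ≤ liminf (fun _ : ℕ => ∑' p, term p) atTop := liminf_le_liminf (Eventually.of_forall hb)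
      _ = _ := by simp

/-- finite continued fractions -/
noncomputable def cfu : ℕ → (ℕ → ℕ) → ℝ
  | 0, _ => 0
  | n + 1, w => ((w 0 : ℝ) + cfu n (fun i => w (i + 1)))⁻¹

lemma cfu_nonneg (n : ℕ) (w : ℕ → ℕ) : 0 ≤ cfu n w := by
  induction n generalizing w with
  | zero => simp [cfu]
  | succ n ih =>
    have := ih (fun i => w (i + 1))
    simp only [cfu]; positivity

lemma cfu_step (n : ℕ) (w : ℕ → ℕ) (hw : ∀ i, 2 ≤ w i) :
    |cfu n w - cfu (n + 1) w| ≤ 1 * (1 / 4) ^ n := by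
  induction n generalizing w with
  | zero =>
    have h2 : (2 : ℝ) ≤ w 0 := by exact_mod_cast hw 0
    simp only [cfu, zero_sub, abs_neg, add_zero, pow_zero, mul_one]
    rw [abs_of_nonneg (by positivity)]
    exact inv_le_one_of_one_le₀ (by linarith)
  | succ n ih =>
    have h2 : (2 : ℝ) ≤ w 0 := by exact_mod_cast hw 0
    have h := ih (fun i => w (i + 1)) (fun i => hw _)
    have p0 := cfu_nonneg n (fun i => w (i + 1))
    have q0 := cfu_nonneg (n + 1) (fun i => w (i + 1))
    rw [cfu, cfu]
    set p := cfu n (fun i => w (i + 1))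
    set q := cfu (n + 1) (fun i => w (i + 1))
    set m : ℝ := (w 0 : ℝ)
    have e : (m + p)⁻¹ - (m + q)⁻¹ = (q - p) / ((m + p) * (m + q)) := by
      field_simp; ring
    rw [e, abs_div, abs_of_pos (a := (m + p) * (m + q)) (by positivity), div_le_iff₀ (by positivity),
      abs_sub_comm, pow_succ]
    have h4 : 4 ≤ (m + p) * (m + q) := by nlinarith
    have : 0 < (1 / 4 : ℝ) ^ n := by positivity
    nlinarith

/-- value of the infinite continued fraction -/
noncomputable def cfX (w : ℕ → ℕ) : ℝ := limUnder atTop (fun n => cfu n w)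

lemma cfX_tendsto (w : ℕ → ℕ) (hw : ∀ i, 2 ≤ w i) :
    Tendsto (fun n => cfu n w) atTop (nhds (cfX w)) := by
  have : CauchySeq (fun n => cfu n w) :=
    cauchySeq_of_le_geometric (1 / 4) 1 (by norm_num)
      (fun n => by rw [Real.dist_eq]; exact cfu_step n w hw)
  exact this.tendsto_limUnder

lemma cfX_nonneg (w : ℕ → ℕ) (hw : ∀ i, 2 ≤ w i) : 0 ≤ cfX w :=
  ge_of_tendsto' (cfX_tendsto w hw) (fun n => cfu_nonneg n w)

lemma cfX_eq (w : ℕ → ℕ) (hw : ∀ i, 2 ≤ w i) :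
    cfX w = ((w 0 : ℝ) + cfX (fun i => w (i + 1)))⁻¹ := by
  have h2 : (2 : ℝ) ≤ w 0 := by exact_mod_cast hw 0
  have h0 := cfX_nonneg (fun i => w (i + 1)) (fun i => hw _)
  have h1 := (cfX_tendsto w hw).comp (tendsto_add_atTop_nat 1)
  refine tendsto_nhds_unique h1 ?_
  change Tendsto (fun n => ((w 0 : ℝ) + cfu n (fun i => w (i + 1)))⁻¹) _ _
  exact ((cfX_tendsto (fun i => w (i + 1)) (fun i => hw _)).const_add _).inv₀ (by positivity)

lemma cfX_bd (w : ℕ → ℕ) (hw : ∀ i, 2 ≤ w i) : 0 < cfX w ∧ cfX w ≤ 1 / 2 := by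
  have h2 : (2 : ℝ) ≤ w 0 := by exact_mod_cast hw 0
  have h0 := cfX_nonneg (fun i => w (i + 1)) (fun i => hw _)
  rw [cfX_eq w hw]
  refine ⟨by positivity, ?_⟩
  rw [one_div]
  exact inv_anti₀ (by norm_num) (by linarith)

lemma cfX_gauss (w : ℕ → ℕ) (hw : ∀ i, 2 ≤ w i) :
    gaussMap (cfX w) = cfX (fun i => w (i + 1)) ∧ ⌊(cfX w)⁻¹⌋₊ = w 0 := by
  obtain ⟨h0, h1⟩ := cfX_bd (fun i => w (i + 1)) (fun i => hw _)
  have e : (cfX w)⁻¹ = (w 0 : ℝ) + cfX (fun i => w (i + 1)) := by rw [cfX_eq w hw, inv_inv]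
  constructor
  · unfold gaussMap
    rw [e, Int.fract_natCast_add, Int.fract_eq_self]
    constructor <;> linarith
  · rw [e, Nat.floor_eq_iff (by positivity)]
    constructor <;> linarith

lemma cfX_iter (n : ℕ) (w : ℕ → ℕ) (hw : ∀ i, 2 ≤ w i) :
    gaussMap^[n] (cfX w) = cfX (fun i => w (i + n)) := by
  induction n generalizing w with
  | zero => simp
  | succ n ih =>
    rw [Function.iterate_succ_apply, (cfX_gauss w hw).1, ih (fun i => w (i + 1)) (fun i => hw _)]
    congr 1

lemma cfX_digit (n : ℕ) (w : ℕ → ℕ) (hw : ∀ i, 2 ≤ w i) : cfA (n + 1) (cfX w) = w n := by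
  rw [cfA_succ, cfX_iter n w hw, (cfX_gauss _ (fun i => hw _)).2]
  simp

/-- remainders of the Cantor expansion -/
noncomputable def digT (M : ℕ → ℕ) (t : ℝ) : ℕ → ℝ
  | 0 => t
  | n + 1 => Int.fract ((M n : ℝ) * digT M t n)

/-- digits of the Cantor expansion -/
noncomputable def digD (M : ℕ → ℕ) (t : ℝ) (n : ℕ) : ℕ := ⌊(M n : ℝ) * digT M t n⌋₊

lemma digT_mem (M : ℕ → ℕ) (t : ℝ) (ht : t ∈ Set.Ico (0 : ℝ) 1) (n : ℕ) :
    0 ≤ digT M t n ∧ digT M t n < 1 := by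
  cases n with
  | zero => exact ht
  | succ n => exact ⟨Int.fract_nonneg _, Int.fract_lt_one _⟩

lemma digT_succ (M : ℕ → ℕ) (t : ℝ) (ht : t ∈ Set.Ico (0 : ℝ) 1) (n : ℕ) :
    (M n : ℝ) * digT M t n = digD M t n + digT M t (n + 1) := by
  have h := (digT_mem M t ht n).1
  rw [digD, natCast_floor_eq_intCast_floor (by positivity), digT, Int.floor_add_fract]

lemma digD_lt (M : ℕ → ℕ) (hM : ∀ n, 2 ≤ M n) (t : ℝ) (ht : t ∈ Set.Ico (0 : ℝ) 1) (n : ℕ) :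
    digD M t n < M n := by
  obtain ⟨h0, h1⟩ := digT_mem M t ht n
  have : 0 < (M n : ℝ) := by exact_mod_cast (by have := hM n; omega)
  rw [digD, Nat.floor_lt (by positivity)]
  nlinarith

lemma digT_diff (M : ℕ → ℕ) (t u : ℝ) (ht : t ∈ Set.Ico (0 : ℝ) 1) (hu : u ∈ Set.Ico (0 : ℝ) 1)
    (n : ℕ) (h : ∀ i < n, digD M t i = digD M u i) :
    digT M t n - digT M u n = (∏ i ∈ Finset.range n, (M i : ℝ)) * (t - u) := by
  induction n with
  | zero => simp [digT]
  | succ n ih =>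
    have h1 := digT_succ M t ht n
    have h2 := digT_succ M u hu n
    rw [h n (by omega)] at h1
    have h3 := ih (fun i hi => h i (by omega))
    rw [Finset.prod_range_succ, mul_right_comm, ← h3]
    linarith

lemma dig_sep (M : ℕ → ℕ) (hM : ∀ n, 2 ≤ M n) (t u : ℝ) (ht : t ∈ Set.Ico (0 : ℝ) 1)
    (hu : u ∈ Set.Ico (0 : ℝ) 1) (htu : t ≠ u) :
    ∃ n, (∀ i < n, digD M t i = digD M u i) ∧ digD M t n ≠ digD M u n := by
  have hex : ∃ n, digD M t n ≠ digD M u n := by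
    by_contra hcon
    push Not at hcon
    obtain ⟨n, hn⟩ := pow_unbounded_of_one_lt (1 / |t - u|) (one_lt_two)
    have hpos : 0 < |t - u| := abs_pos.mpr (sub_ne_zero.mpr htu)
    rw [div_lt_iff₀ hpos] at hn
    have hd := digT_diff M t u ht hu n (fun i _ => hcon i)
    have h1 := digT_mem M t ht n
    have h2 := digT_mem M u hu n
    have h3 : |digT M t n - digT M u n| ≤ 1 := by rw [abs_le]; constructor <;> linarith
    have h4 : (2 : ℝ) ^ n ≤ ∏ i ∈ Finset.range n, (M i : ℝ) := by
      have := Finset.prod_le_prod (s := Finset.range n) (f := fun _ => (2 : ℝ))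
        (g := fun i => (M i : ℝ)) (fun i _ => by norm_num) (fun i _ => by exact_mod_cast hM i)
      simpa using this
    rw [hd, abs_mul, abs_of_nonneg (by positivity)] at h3
    nlinarith
  classical
  refine ⟨Nat.find hex, fun i hi => ?_, Nat.find_spec hex⟩
  have := Nat.find_min hex hi
  push Not at this
  exact this

/-- the parametrization -/
noncomputable def par (M : ℕ → ℕ) (t : ℝ) : ℝ := cfX (fun n => M n + digD M t n)

lemma par_key (M : ℕ → ℕ) (hM : ∀ n, 2 ≤ M n) (t u : ℝ) (ht : t ∈ Set.Ico (0 : ℝ) 1)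
    (hu : u ∈ Set.Ico (0 : ℝ) 1) (htu : t ≠ u) :
    ∃ n : ℕ, ∃ k : ℝ, 1 ≤ k ∧ k ≤ M n ∧
      |t - u| * ((∏ i ∈ Finset.range n, (M i : ℝ)) * M n) ≤ 2 * k ∧
      k ≤ 2 * 4 ^ (n + 1) * ((∏ i ∈ Finset.range n, (M i : ℝ)) * M n) ^ 2 * |par M t - par M u| := by
  obtain ⟨n, hn, hne⟩ := dig_sep M hM t u ht hu htu
  have hw : ∀ v : ℝ, ∀ i, 2 ≤ M i + digD M v i := fun v i => by have := hM i; omega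
  have hD1 := digD_lt M hM t ht n
  have hD2 := digD_lt M hM u hu n
  have hk1 : (1 : ℝ) ≤ |(digD M t n : ℝ) - digD M u n| := by
    have h0 : (digD M t n : ℤ) - digD M u n ≠ 0 := by omega
    have := Int.one_le_abs h0
    exact_mod_cast this
  have hk2 : |(digD M t n : ℝ) - digD M u n| ≤ M n := by
    have h1 : (digD M t n : ℝ) < M n := by exact_mod_cast hD1
    have h2 : (digD M u n : ℝ) < M n := by exact_mod_cast hD2
    have h3 : (0 : ℝ) ≤ digD M t n := by positivity
    have h4 : (0 : ℝ) ≤ digD M u n := by positivity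
    rw [abs_le]; constructor <;> linarith
  set Q : ℝ := ∏ i ∈ Finset.range n, (M i : ℝ) with hQ
  have hMpos : ∀ i, (0 : ℝ) < M i := fun i => by exact_mod_cast (by have := hM i; omega)
  have hQpos : 0 < Q := Finset.prod_pos (fun i _ => hMpos i)
  refine ⟨n, _, hk1, hk2, ?_, ?_⟩
  · have hd := digT_diff M t u ht hu n hn
    have h1 := digT_succ M t ht n
    have h2 := digT_succ M u hu n
    have h3 := digT_mem M t ht (n + 1)
    have h4 := digT_mem M u hu (n + 1)
    have e : (t - u) * (Q * M n) = ((digD M t n : ℝ) - digD M u n) +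
        (digT M t (n + 1) - digT M u (n + 1)) := by
      have : (t - u) * (Q * M n) = M n * (Q * (t - u)) := by ring
      rw [this, ← hd]; linarith
    have h5 : |digT M t (n + 1) - digT M u (n + 1)| ≤ 1 := by rw [abs_le]; constructor <;> linarith
    have hp : 0 < Q * M n := mul_pos hQpos (hMpos n)
    rw [← abs_of_pos hp, ← abs_mul, e]
    refine (abs_add_le _ _).trans ?_
    linarith
  · set X := gaussMap^[n] (par M t) with hX
    set Y := gaussMap^[n] (par M u) with hY
    have hxy : |X - Y| ≤ |par M t - par M u| *
        (∏ i ∈ Finset.range n, (((M i + digD M t i : ℕ) : ℝ) + 1)) ^ 2 :=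
      (iter_diff (x := par M t) (y := par M u) (v := fun i => M i + digD M t i) n
        (fun i _ => by have := hM i; omega) (fun i _ => cfX_digit i _ (hw t))
        (fun i hi => by rw [hn i hi]; exact cfX_digit i _ (hw u))).2
    have hprod : ∏ i ∈ Finset.range n, (((M i + digD M t i : ℕ) : ℝ) + 1) ≤ 2 ^ n * Q := by
      have : (2 : ℝ) ^ n * Q = ∏ i ∈ Finset.range n, (2 * (M i : ℝ)) := by
        rw [Finset.prod_mul_distrib]; simp [hQ]
      rw [this]
      apply Finset.prod_le_prod (fun i _ => by positivity)
      intro i _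
      have := digD_lt M hM t ht i
      exact_mod_cast (by omega : M i + digD M t i + 1 ≤ 2 * M i)
    have hcore : |(digD M t n : ℝ) - digD M u n| ≤ 2 * (2 * M n) ^ 2 * |X - Y| := by
      have a1 : ⌊X⁻¹⌋₊ = M n + digD M t n := by
        rw [hX, ← cfA_succ]; exact cfX_digit n _ (hw t)
      have a2 : ⌊Y⁻¹⌋₊ = M n + digD M u n := by
        rw [hY, ← cfA_succ]; exact cfX_digit n _ (hw u)
      obtain ⟨x0, x1, x2, x3⟩ := gauss_eq (by have := hM n; omega) a1
      obtain ⟨y0, y1, y2, y3⟩ := gauss_eq (by have := hM n; omega) a2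
      have gX : 0 < gaussMap X ∧ gaussMap X ≤ 1 / 2 := by
        rw [hX, ← Function.iterate_succ_apply' gaussMap, par, cfX_iter _ _ (hw t)]
        exact cfX_bd _ (fun i => hw t _)
      have gY : 0 < gaussMap Y ∧ gaussMap Y ≤ 1 / 2 := by
        rw [hY, ← Function.iterate_succ_apply' gaussMap, par, cfX_iter _ _ (hw u)]
        exact cfX_bd _ (fun i => hw u _)
      have b1 : (1 : ℝ) ≤ 2 * M n * X := by
        have : ((M n + digD M t n : ℕ) : ℝ) + 1 ≤ 2 * M n := by
          exact_mod_cast (by omega : M n + digD M t n + 1 ≤ 2 * M n)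
        nlinarith
      have b2 : (1 : ℝ) ≤ 2 * M n * Y := by
        have : ((M n + digD M u n : ℕ) : ℝ) + 1 ≤ 2 * M n := by
          exact_mod_cast (by omega : M n + digD M u n + 1 ≤ 2 * M n)
        nlinarith
      have e1 : |X - Y| = X * Y * |X⁻¹ - Y⁻¹| := by
        have e2 : Y - X = X * Y * (X⁻¹ - Y⁻¹) := by field_simp
        rw [abs_sub_comm, e2, abs_mul, abs_of_pos (mul_pos x0 y0)]
      have e3 : |(digD M t n : ℝ) - digD M u n| ≤ 2 * |X⁻¹ - Y⁻¹| := by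
        have e4 : (digD M t n : ℝ) - digD M u n =
            (X⁻¹ - Y⁻¹) - (gaussMap X - gaussMap Y) := by
          rw [x3, y3]; push_cast; ring
        have e5 : |gaussMap X - gaussMap Y| ≤ 1 / 2 := by rw [abs_le]; constructor <;> linarith
        have e6 := abs_sub (X⁻¹ - Y⁻¹) (gaussMap X - gaussMap Y)
        rw [← e4] at e6
        linarith
      have e7 : 1 ≤ (2 * M n) ^ 2 * (X * Y) := by
        have : (2 * (M n : ℝ)) ^ 2 * (X * Y) = (2 * M n * X) * (2 * M n * Y) := by ring
        rw [this]; exact one_le_mul_of_one_le_of_one_le b1 b2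
      have e8 := abs_nonneg (X⁻¹ - Y⁻¹)
      have e9 : 2 * (2 * (M n : ℝ)) ^ 2 * |X - Y| =
        ((2 * M n) ^ 2 * (X * Y)) * (2 * |X⁻¹ - Y⁻¹|) := by rw [e1]; ring
      rw [e9]
      nlinarith
    calc _ ≤ 2 * (2 * M n) ^ 2 * |X - Y| := hcore
      _ ≤ 2 * (2 * M n) ^ 2 * (|par M t - par M u| * (2 ^ n * Q) ^ 2) := by
        gcongr
        refine hxy.trans ?_
        gcongr
      _ = _ := by
        have : (4 : ℝ) ^ (n + 1) = 4 * (2 ^ n) ^ 2 := by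
          rw [← pow_mul, mul_comm n 2, pow_mul]; norm_num [pow_succ]; ring
        rw [this]; ring

open NNReal ENNReal in
lemma lower_general (M : ℕ → ℕ) (hM : ∀ n, 2 ≤ M n) (s : ℝ≥0) (hs0 : 0 < s) (hs1 : s ≤ 1) (C : ℝ)
    (hC : ∀ n : ℕ, 2 / (∏ i ∈ Finset.range n, (M i : ℝ)) *
      (2 * 4 ^ (n + 1) * (∏ i ∈ Finset.range n, (M i : ℝ)) ^ 2 * M n) ^ (s : ℝ) ≤ C) :
    (s : ℝ≥0∞) ≤ dimH (par M '' Set.Ico 0 1) := by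
  have hMpos : ∀ i, (0 : ℝ) < M i := fun i => by exact_mod_cast (by have := hM i; omega)
  have hC0 : 0 ≤ C := by
    refine le_trans ?_ (hC 0)
    positivity
  have hs0' : (0 : ℝ) < s := hs0
  have hs1' : (s : ℝ) ≤ 1 := hs1
  have hold : ∀ t ∈ Set.Ico (0 : ℝ) 1, ∀ u ∈ Set.Ico (0 : ℝ) 1,
      |t - u| ≤ C * |par M t - par M u| ^ (s : ℝ) := by
    intro t ht u hu
    by_cases htu : t = u
    · subst htu; simp; positivity
    obtain ⟨n, k, hk1, hk2, h1, h2⟩ := par_key M hM t u ht hu htu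
    have hc := hC n
    have hQpos : 0 < ∏ i ∈ Finset.range n, (M i : ℝ) := Finset.prod_pos (fun i _ => hMpos i)
    set Q : ℝ := ∏ i ∈ Finset.range n, (M i : ℝ) with hQ
    have hm := hMpos n
    set m : ℝ := (M n : ℝ)
    set d := |par M t - par M u| with hd
    have hd0 : 0 ≤ d := abs_nonneg _
    have hρ0 : 0 < k / m := by positivity
    have hρ1 : k / m ≤ 1 := (div_le_one hm).mpr hk2
    have hρ : k / m ≤ (k / m) ^ (s : ℝ) := by
      have := Real.rpow_le_rpow_of_exponent_ge hρ0 hρ1 hs1'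
      simpa using this
    have hρ2 : k / m ≤ (2 * 4 ^ (n + 1) * Q ^ 2 * m) * d := by
      rw [div_le_iff₀ hm]
      refine h2.trans (le_of_eq ?_)
      ring
    calc |t - u| ≤ 2 / Q * (k / m) := by
          have : 2 / Q * (k / m) = 2 * k / (Q * m) := by field_simp
          rw [this, le_div_iff₀ (by positivity)]; exact h1
      _ ≤ 2 / Q * (k / m) ^ (s : ℝ) := by gcongr
      _ ≤ 2 / Q * ((2 * 4 ^ (n + 1) * Q ^ 2 * m) * d) ^ (s : ℝ) := by gcongr
      _ = (2 / Q * (2 * 4 ^ (n + 1) * Q ^ 2 * m) ^ (s : ℝ)) * d ^ (s : ℝ) := by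
          rw [Real.mul_rpow (by positivity) hd0]; ring
      _ ≤ C * d ^ (s : ℝ) := by gcongr
  have hinj : Set.InjOn (par M) (Set.Ico 0 1) := by
    intro t ht u hu h
    have := hold t ht u hu
    rw [h, sub_self, abs_zero, Real.zero_rpow hs0'.ne', mul_zero] at this
    have := abs_nonpos_iff.mp this
    linarith
  let f := Function.invFunOn (par M) (Set.Ico (0 : ℝ) 1)
  have hf : ∀ t ∈ Set.Ico (0 : ℝ) 1, f (par M t) = t := fun t ht => hinj.leftInvOn_invFunOn ht
  have hH : HolderOnWith C.toNNReal s f (par M '' Set.Ico 0 1) := by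
    rintro _ ⟨t, ht, rfl⟩ _ ⟨u, hu, rfl⟩
    rw [hf t ht, hf u hu, edist_dist, edist_dist, Real.dist_eq, Real.dist_eq,
      ENNReal.ofReal_rpow_of_nonneg (abs_nonneg _) hs0'.le]
    change _ ≤ ENNReal.ofReal C * _
    rw [← ENNReal.ofReal_mul hC0]
    exact ENNReal.ofReal_le_ofReal (hold t ht u hu)
  have himg : f '' (par M '' Set.Ico 0 1) = Set.Ico 0 1 := by
    rw [Set.image_image]
    ext z
    constructor
    · rintro ⟨t, ht, rfl⟩
      simp only [hf t ht]; exact ht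
    · intro hz
      exact ⟨z, hz, hf z hz⟩
  have h := hH.dimH_image_le hs0
  rw [himg, Real.dimH_of_nonempty_interior (by simp [interior_Ico])] at h
  simp only [Module.finrank_self, Nat.cast_one] at h
  have hsn : (s : ℝ≥0∞) ≠ 0 := by exact_mod_cast hs0.ne'
  rw [ENNReal.le_div_iff_mul_le (Or.inl hsn) (Or.inl ENNReal.coe_ne_top), one_mul] at h
  exact h

lemma geom_aux (b : ℝ) (hb : 1 < b) (n : ℕ) :
    ∑ i ∈ Finset.range n, b ^ (i + 1) = (b ^ (n + 1) - b) / (b - 1) := by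
  have h : b - 1 ≠ 0 := by linarith
  induction n with
  | zero => simp
  | succ n ih =>
    rw [Finset.sum_range_succ, ih]
    field_simp; ring

open NNReal ENNReal in
lemma lower_bound (a b : ℝ) (ha : 1 < a) (hb : 1 < b) (s : ℝ≥0) (hs0 : 0 < s)
    (hs : (s : ℝ) < 1 / (b + 1)) :
    (s : ℝ≥0∞) ≤ dimH {x | x ∈ Lam ∧ ∀ n : ℕ, 1 ≤ n → a ^ (b ^ n) ≤ (cfA n x : ℝ)} := by
  have hb1 : 0 < b - 1 := by linarith
  have hb0 : 0 < b := by linarith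
  set c : ℝ := max a (max 2 (3 ^ (1 / (b - 1)))) with hc
  have hca : a ≤ c := le_max_left _ _
  have hc2 : 2 ≤ c := (le_max_left _ _).trans (le_max_right _ _)
  have hc3 : 3 ≤ c ^ (b - 1) := by
    have h1 : (3 : ℝ) ^ (1 / (b - 1)) ≤ c := (le_max_right _ _).trans (le_max_right _ _)
    have h2 := Real.rpow_le_rpow (by positivity) h1 hb1.le
    rw [← Real.rpow_mul (by norm_num), one_div_mul_cancel hb1.ne', Real.rpow_one] at h2
    exact h2
  have hc0 : 0 < c := by linarith
  have hc1 : 1 ≤ c := by linarith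
  let M : ℕ → ℕ := fun n => ⌈c ^ (b ^ (n + 1))⌉₊
  have hbn : ∀ n : ℕ, 1 ≤ b ^ n := fun n => one_le_pow₀ hb.le
  have hlow : ∀ n, c ^ (b ^ (n + 1)) ≤ (M n : ℝ) := fun n => Nat.le_ceil _
  have hge2 : ∀ n : ℕ, 2 ≤ c ^ (b ^ (n + 1)) := fun n => by
    have := Real.rpow_le_rpow_of_exponent_le hc1 (hbn (n + 1))
    rw [Real.rpow_one] at this; linarith
  have hup : ∀ n, (M n : ℝ) < c ^ (b ^ (n + 1)) + 1 := fun n => Nat.ceil_lt_add_one (by positivity)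
  have hM : ∀ n, 2 ≤ M n := fun n => by
    have : (2 : ℝ) ≤ M n := (hge2 n).trans (hlow n)
    exact_mod_cast this
  have hmono : ∀ n, 2 * M n ≤ M (n + 1) + 1 := fun n => by
    have h1 : 3 * c ^ (b ^ (n + 1)) ≤ c ^ (b ^ (n + 1 + 1)) := by
      have e : b ^ (n + 1 + 1) = b ^ (n + 1) + (b - 1) * b ^ (n + 1) := by ring
      rw [e, Real.rpow_add hc0, mul_comm]
      gcongr
      refine hc3.trans ?_
      apply Real.rpow_le_rpow_of_exponent_le hc1
      nlinarith [hbn (n + 1)]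
    have h2 : (2 : ℝ) * M n ≤ M (n + 1) + 1 := by
      linarith [hlow (n + 1), hup n, hge2 n]
    exact_mod_cast h2
  have hsub : par M '' Set.Ico 0 1 ⊆
      {x | x ∈ Lam ∧ ∀ n : ℕ, 1 ≤ n → a ^ (b ^ n) ≤ (cfA n x : ℝ)} := by
    rintro _ ⟨t, ht, rfl⟩
    have hw : ∀ i, 2 ≤ M i + digD M t i := fun i => by have := hM i; omega
    have hA : ∀ n, cfA (n + 1) (par M t) = M n + digD M t n := fun n => cfX_digit n _ hw
    have hbd := cfX_bd _ hw
    refine ⟨⟨⟨hbd.1, ?_⟩, ?_⟩, ?_⟩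
    · have := hbd.2
      change cfX _ < 1
      linarith
    · intro n hn
      obtain ⟨m, rfl⟩ : ∃ m, n = m + 1 := ⟨n - 1, by omega⟩
      rw [hA, hA]
      have h1 := digD_lt M hM t ht m
      have h2 := hmono m
      omega
    · intro n hn
      obtain ⟨m, rfl⟩ : ∃ m, n = m + 1 := ⟨n - 1, by omega⟩
      rw [hA]
      have h1 : a ^ (b ^ (m + 1)) ≤ c ^ (b ^ (m + 1)) := by gcongr
      push_cast
      have h2 : (0 : ℝ) ≤ digD M t m := by positivity
      linarith [hlow m]
  refine le_trans ?_ (dimH_mono hsub)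
  have hs' : (s : ℝ) * (b + 1) < 1 := by rwa [lt_div_iff₀ (by linarith)] at hs
  have hs0' : (0 : ℝ) < s := hs0
  have hβ : 0 < Real.log c := Real.log_pos (by linarith)
  set β := Real.log c with hβd
  set κ : ℝ := β * b * ((1 - s * (b + 1)) / (b - 1)) with hκd
  have hκ : 0 < κ := by
    have : 0 < (1 - s * (b + 1)) / (b - 1) := div_pos (by linarith) hb1
    positivity
  obtain ⟨C, hC⟩ := lin_le_exp (s * Real.log 4) κ b hκ hb
  have hs1 : (s : ℝ) ≤ 1 := by nlinarith
  refine lower_general M hM s hs0 (by exact_mod_cast hs1)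
    (Real.exp (C + Real.log 2 + s * (Real.log 2 + Real.log 4 + Real.log 2) +
      (1 - 2 * s) * (β * (b / (b - 1))))) (fun n => ?_)
  have hMpos : ∀ i, (0 : ℝ) < M i := fun i => by linarith [hge2 i, hlow i]
  have hQpos : 0 < ∏ i ∈ Finset.range n, (M i : ℝ) := Finset.prod_pos (fun i _ => hMpos i)
  have hQlog : β * ((b ^ (n + 1) - b) / (b - 1)) ≤
      Real.log (∏ i ∈ Finset.range n, (M i : ℝ)) := by
    rw [Real.log_prod (fun i _ => (hMpos i).ne'), ← geom_aux b hb, Finset.mul_sum]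
    apply Finset.sum_le_sum
    intro i _
    have := Real.log_le_log (by positivity) (hlow i)
    rw [Real.log_rpow hc0] at this
    linarith
  have hMlog : Real.log (M n) ≤ Real.log 2 + β * b ^ (n + 1) := by
    have h1 : (M n : ℝ) ≤ 2 * c ^ (b ^ (n + 1)) := by linarith [hup n, hge2 n]
    have := Real.log_le_log (hMpos n) h1
    rw [Real.log_mul (by norm_num) (by positivity), Real.log_rpow hc0] at this
    linarith
  set Q : ℝ := ∏ i ∈ Finset.range n, (M i : ℝ) with hQ
  have hm := hMpos n
  set m : ℝ := (M n : ℝ)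
  rw [← Real.log_le_iff_le_exp (by positivity), Real.log_mul (by positivity) (by positivity),
    Real.log_rpow (by positivity), Real.log_div (by norm_num) hQpos.ne',
    Real.log_mul (by positivity) (by positivity), Real.log_mul (by positivity) (by positivity),
    Real.log_mul (by positivity) (by positivity), Real.log_pow, Real.log_pow]
  have hn := hC n
  have h12 : 0 < 1 - 2 * (s : ℝ) := by nlinarith
  have k1 := mul_le_mul_of_nonneg_left hQlog h12.le
  have k2 := mul_le_mul_of_nonneg_left hMlog hs0'.le
  have e : (1 - 2 * (s : ℝ)) * (β * ((b ^ (n + 1) - b) / (b - 1))) - s * (β * b ^ (n + 1))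
      = κ * b ^ n - (1 - 2 * s) * (β * (b / (b - 1))) := by
    rw [hκd]; field_simp; ring
  push_cast
  nlinarith

/-- For `a, b > 1`, both `F(Λ,a,b) = {x ∈ Λ : aₙ(x) ≥ a^{bⁿ} ∀n}` and
`F̃(Λ,a,b) = {x ∈ Λ : aₙ(x) ≥ a^{bⁿ} i.o.}` have Hausdorff dimension `1/(b+1)`. -/
theorem dimH_F_and_Ftilde (a b : ℝ) (ha : 1 < a) (hb : 1 < b) :
    dimH {x | x ∈ Lam ∧ ∀ n : ℕ, 1 ≤ n → a ^ (b ^ n) ≤ (cfA n x : ℝ)} =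
        ENNReal.ofReal (1 / (b + 1)) ∧
    dimH {x | x ∈ Lam ∧ ∃ᶠ n : ℕ in atTop, a ^ (b ^ n) ≤ (cfA n x : ℝ)} =
        ENNReal.ofReal (1 / (b + 1)) := by
  have hsub : {x | x ∈ Lam ∧ ∀ n : ℕ, 1 ≤ n → a ^ (b ^ n) ≤ (cfA n x : ℝ)} ⊆
      {x | x ∈ Lam ∧ ∃ᶠ n : ℕ in atTop, a ^ (b ^ n) ≤ (cfA n x : ℝ)} := by
    rintro x ⟨h1, h2⟩
    refine ⟨h1, Eventually.frequently ?_⟩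
    filter_upwards [eventually_ge_atTop 1] with n hn using h2 n hn
  have hmono := dimH_mono hsub
  have hpos : 0 < 1 / (b + 1) := by positivity
  have hup : dimH {x | x ∈ Lam ∧ ∃ᶠ n : ℕ in atTop, a ^ (b ^ n) ≤ (cfA n x : ℝ)} ≤
      ENNReal.ofReal (1 / (b + 1)) := by
    apply le_of_forall_gt
    intro r hr
    obtain ⟨s, hs1, hs2⟩ := ENNReal.lt_iff_exists_nnreal_btwn.mp hr
    refine lt_of_le_of_lt (upper_bound a b ha hb s ?_) hs2
    rw [← ENNReal.ofReal_coe_nnreal, ENNReal.ofReal_lt_ofReal_iff_of_nonneg hpos.le] at hs1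
    exact hs1
  have hlow : ENNReal.ofReal (1 / (b + 1)) ≤
      dimH {x | x ∈ Lam ∧ ∀ n : ℕ, 1 ≤ n → a ^ (b ^ n) ≤ (cfA n x : ℝ)} := by
    apply le_of_forall_lt
    intro r hr
    obtain ⟨s, hs1, hs2⟩ := ENNReal.lt_iff_exists_nnreal_btwn.mp hr
    refine lt_of_lt_of_le hs1 (lower_bound a b ha hb s ?_ ?_)
    · have := lt_of_le_of_lt (zero_le (a := r)) hs1
      exact_mod_cast this
    · rw [← ENNReal.ofReal_coe_nnreal, ENNReal.ofReal_lt_ofReal_iff hpos] at hs2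
      exact hs2
  exact ⟨le_antisymm (hmono.trans hup) hlow, le_antisymm hup (hlow.trans hmono)⟩
end
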